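/- Let r, c ≥ 1 and n = rc, and let P, Q ∈ SYT(r×c). Then prom_r^NE(stack(P,Q)) is a permutation of {1,…,n} and equals the permutation RS⁻¹(Q^⊤, P^⊤), i.e. the permutation whose Robinson–Schensted insertion tableau is Q^⊤ and whose recording tableau is P^⊤. -/

import Mathlib

namespace PromRS

/-! ## Rectangular standard Young tableaux (as functions; 0-indexed cells; entries 1..R*C) -/

/-- `T` is a standard Young tableau of rectangular shape with `R` rows and `C` columns:
rows and columns strictly increase, and the entries on the `R × C` rectangle are a
bijection onto `{1, …, R*C}`. -/
def IsSYT (R C : ℕ) (T : ℕ → ℕ → ℕ) : Prop :=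
  (∀ i j, i < R → j + 1 < C → T i j < T i (j + 1)) ∧
  (∀ i j, i + 1 < R → j < C → T i j < T (i + 1) j) ∧
  Set.BijOn (fun p : ℕ × ℕ => T p.1 p.2) {p : ℕ × ℕ | p.1 < R ∧ p.2 < C} (Set.Icc 1 (R * C))

/-- Stacking: add `r*c` to every entry of `Q` and place the result below `P`. -/
def stack (r c : ℕ) (P Q : ℕ → ℕ → ℕ) : ℕ → ℕ → ℕ := fun i j =>
  if i < r then P i j else Q (i - r) j + r * c

/-! ## Gromotion and promotion permutations -/

/-- Value of `T` at a cell, with `⊤` outside the `R × C` rectangle. -/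
def ext (R C : ℕ) (T : ℕ → ℕ → ℕ) (p : ℕ × ℕ) : WithTop ℕ :=
  if p.1 < R ∧ p.2 < C then ((T p.1 p.2 : ℕ) : WithTop ℕ) else ⊤

/-- The jeu de taquin slide moves the empty cell to the smaller of its east/south neighbors. -/
def nextCell (R C : ℕ) (T : ℕ → ℕ → ℕ) (p : ℕ × ℕ) : ℕ × ℕ :=
  if ext R C T (p.1, p.2 + 1) < ext R C T (p.1 + 1, p.2) then (p.1, p.2 + 1)
  else (p.1 + 1, p.2)

/-- The sliding path of the empty cell, starting at the top-left corner. -/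
def slidePath (R C : ℕ) (T : ℕ → ℕ → ℕ) : ℕ → ℕ × ℕ
  | 0 => (0, 0)
  | k + 1 => nextCell R C T (slidePath R C T k)

def maxEntry (R C : ℕ) (T : ℕ → ℕ → ℕ) : ℕ :=
  ((Finset.range R) ×ˢ (Finset.range C)).sup fun p => T p.1 p.2

/-- Gromotion: delete the minimal entry (at the top-left corner), rectify by jeu de taquin
slides, and fill the vacated outer corner with (current maximum) + 1; entries are not
decremented. -/
def gromotion (R C : ℕ) (T : ℕ → ℕ → ℕ) : ℕ → ℕ → ℕ := fun i j =>
  if i = R - 1 ∧ j = C - 1 then maxEntry R C T + 1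
  else
    match (List.range (R + C - 2)).find? (fun k => decide (slidePath R C T k = (i, j))) with
    | some k => T (slidePath R C T (k + 1)).1 (slidePath R C T (k + 1)).2
    | none => T i j

/-- The entry that slides (up) into row `i` (1-indexed) during one gromotion slide of `T`:
the value of `T` at the first cell of the sliding path lying in 0-indexed row `i`. -/
def slideInto (R C : ℕ) (T : ℕ → ℕ → ℕ) (i : ℕ) : ℕ :=
  match (List.range (R + C - 1)).find? (fun k => decide ((slidePath R C T k).1 = i)) with
  | some k => T (slidePath R C T k).1 (slidePath R C T k).2
  | none => 0

/-- The `i`-th promotion permutation of `T ∈ SYT(R × C)`: its value at `j` is the entry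
that slides into row `i` when computing `gromotion^j(T)`, taken modulo `R*C` with
residues in `{1, …, R*C}`. -/
def promPerm (R C : ℕ) (T : ℕ → ℕ → ℕ) (i : ℕ) : ℕ → ℕ := fun j =>
  (slideInto R C ((gromotion R C)^[j - 1] T) i - 1) % (R * C) + 1

/-! ## Tableaux as lists of rows, Robinson–Schensted insertion -/

/-- Entry of a list-of-rows tableau (0-indexed; `0` outside). -/
def entryL (T : List (List ℕ)) (i j : ℕ) : ℕ := (T.getD i []).getD j 0

/-- Convert a function tableau on an `R × C` rectangle to a list of rows. -/
def toListT (R C : ℕ) (T : ℕ → ℕ → ℕ) : List (List ℕ) :=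
  (List.range R).map fun i => (List.range C).map fun j => T i j

/-- Transpose (conjugate) of a list-of-rows tableau. -/
def transposeT (T : List (List ℕ)) : List (List ℕ) :=
  (List.range (T.getD 0 []).length).map fun j => T.filterMap fun row => row[j]?

/-- Shape (row lengths) of a list-of-rows tableau. -/
def shapeL (T : List (List ℕ)) : List ℕ := T.map List.length

/-- Standard Young tableau, as a list of rows: weakly decreasing nonempty row lengths,
rows and columns strictly increasing, and entries exactly `{1, …, N}` where `N` is the
number of cells. -/
def IsSYTList (T : List (List ℕ)) : Prop :=
  (∀ i, i + 1 < T.length → (T.getD (i + 1) []).length ≤ (T.getD i []).length) ∧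
  (∀ row ∈ T, row ≠ []) ∧
  (∀ i j, i < T.length → j + 1 < (T.getD i []).length → entryL T i j < entryL T i (j + 1)) ∧
  (∀ i j, i + 1 < T.length → j < (T.getD (i + 1) []).length →
    entryL T i j < entryL T (i + 1) j) ∧
  T.flatten.Nodup ∧ (∀ m, m ∈ T.flatten ↔ 1 ≤ m ∧ m ≤ T.flatten.length)

/-- Schensted row insertion of `x` into a tableau. -/
def rowInsert : List (List ℕ) → ℕ → List (List ℕ)
  | [], x => [[x]]
  | r :: rs, x =>
    match r.dropWhile (fun y => decide (y < x)) with
    | [] => (r ++ [x]) :: rs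
    | y :: bs => (r.takeWhile (fun y => decide (y < x)) ++ x :: bs) :: rowInsert rs y

/-- The (0-indexed) row where the shape grew when passing from `P` to `P'`. -/
def rowOfNewCell (P P' : List (List ℕ)) : ℕ :=
  ((List.range P'.length).find? fun i =>
    decide ((P'.getD i []).length ≠ (P.getD i []).length)).getD 0

def placeInRow (Q : List (List ℕ)) (r k : ℕ) : List (List ℕ) :=
  if r < Q.length then Q.set r (Q.getD r [] ++ [k]) else Q ++ [[k]]

/-- The Robinson–Schensted correspondence: the pair (insertion tableau, recording tableau)
of a word. -/
def RS (w : List ℕ) : List (List ℕ) × List (List ℕ) :=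
  (List.range w.length).foldl
    (fun PQ i =>
      let P' := rowInsert PQ.1 (w.getD i 0)
      (P', placeInRow PQ.2 (rowOfNewCell PQ.1 P') (i + 1)))
    ([], [])

/-! ## Jeu de taquin on list tableaux; evacuation -/

def extL (T : List (List ℕ)) (p : ℕ × ℕ) : WithTop ℕ :=
  if p.2 < (T.getD p.1 []).length then ((entryL T p.1 p.2 : ℕ) : WithTop ℕ) else ⊤

def nextCellL (T : List (List ℕ)) (p : ℕ × ℕ) : ℕ × ℕ :=
  if extL T (p.1, p.2 + 1) = ⊤ ∧ extL T (p.1 + 1, p.2) = ⊤ then p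
  else if extL T (p.1, p.2 + 1) < extL T (p.1 + 1, p.2) then (p.1, p.2 + 1)
  else (p.1 + 1, p.2)

def jdtPath (T : List (List ℕ)) : ℕ → ℕ × ℕ
  | 0 => (0, 0)
  | k + 1 => nextCellL T (jdtPath T k)

/-- The outer corner vacated when the minimal entry of `T` is deleted and the tableau is
rectified by jeu de taquin slides. -/
def vacated (T : List (List ℕ)) : ℕ × ℕ := jdtPath T T.flatten.length

/-- The value at cell `(i, j)` after the rectification slide. -/
def slidValue (T : List (List ℕ)) (i j : ℕ) : ℕ :=
  match (List.range T.flatten.length).find? (fun k =>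
      decide (jdtPath T k = (i, j) ∧ jdtPath T (k + 1) ≠ (i, j))) with
  | some k => entryL T (jdtPath T (k + 1)).1 (jdtPath T (k + 1)).2
  | none => entryL T i j

/-- Delete the minimal entry of `T` and rectify. -/
def delta (T : List (List ℕ)) : List (List ℕ) :=
  ((List.range T.length).map fun i =>
    (List.range ((T.getD i []).length - if i = (vacated T).1 then 1 else 0)).map fun j =>
      slidValue T i j).filter fun row => decide (row ≠ [])

/-- The entry of the evacuation `∂T` at cell `(i,j)`: `n + 1 - k` where the `k`-th
deletion-rectification vacates `(i,j)`. -/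
def evacEntry (T : List (List ℕ)) (i j : ℕ) : ℕ :=
  match (List.range T.flatten.length).find? (fun k =>
      decide (vacated (delta^[k] T) = (i, j))) with
  | some k => T.flatten.length - k
  | none => 0

/-- Schützenberger evacuation `∂T` of a standard Young tableau. -/
def evacL (T : List (List ℕ)) : List (List ℕ) :=
  (List.range T.length).map fun i =>
    (List.range (T.getD i []).length).map fun j => evacEntry T i j

/-! ## Shadow lines, skeleta, and Viennot's construction -/

def dirNE (a b : ℤ × ℤ) : Prop := a.1 ≤ b.1 ∧ a.2 ≤ b.2
def dirSE (a b : ℤ × ℤ) : Prop := a.1 ≤ b.1 ∧ b.2 ≤ a.2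
def dirSW (a b : ℤ × ℤ) : Prop := b.1 ≤ a.1 ∧ b.2 ≤ a.2
def dirNW (a b : ℤ × ℤ) : Prop := b.1 ≤ a.1 ∧ a.2 ≤ b.2

def minimalsUnder (d : ℤ × ℤ → ℤ × ℤ → Prop) (P : Set (ℤ × ℤ)) : Set (ℤ × ℤ) :=
  {p ∈ P | ∀ q ∈ P, d q p → q = p}

/-- `P` minus its first `j` shadow lines. -/
def shadowRest (d : ℤ × ℤ → ℤ × ℤ → Prop) (P : Set (ℤ × ℤ)) : ℕ → Set (ℤ × ℤ)
  | 0 => P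
  | j + 1 => shadowRest d P j \ minimalsUnder d (shadowRest d P j)

/-- The `j`-th shadow line of `P` (1-indexed `j`). -/
def shadowLine (d : ℤ × ℤ → ℤ × ℤ → Prop) (P : Set (ℤ × ℤ)) (j : ℕ) : Set (ℤ × ℤ) :=
  minimalsUnder d (shadowRest d P (j - 1))

/-- The skeleton of a single shadow line `L`: the minimal elements of the set of points
covered by the shadows of at least two points of `L`. -/
def lineSkeleton (d : ℤ × ℤ → ℤ × ℤ → Prop) (L : Set (ℤ × ℤ)) : Set (ℤ × ℤ) :=
  minimalsUnder d {x | ∃ p ∈ L, ∃ q ∈ L, p ≠ q ∧ d p x ∧ d q x}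

/-- The skeleton of `P`: the union of the skeleta of its shadow lines. -/
def skeleton (d : ℤ × ℤ → ℤ × ℤ → Prop) (P : Set (ℤ × ℤ)) : Set (ℤ × ℤ) :=
  ⋃ j : ℕ, lineSkeleton d (shadowLine d P (j + 1))

/-- The `k`-th iterated skeleton of `P`. -/
def skeletonIter (d : ℤ × ℤ → ℤ × ℤ → Prop) (P : Set (ℤ × ℤ)) (k : ℕ) : Set (ℤ × ℤ) :=
  (skeleton d)^[k] P

def IsMinSnd (L : Set (ℤ × ℤ)) (y : ℤ) : Prop := (∃ p ∈ L, p.2 = y) ∧ ∀ p ∈ L, y ≤ p.2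
def IsMaxSnd (L : Set (ℤ × ℤ)) (y : ℤ) : Prop := (∃ p ∈ L, p.2 = y) ∧ ∀ p ∈ L, p.2 ≤ y
def IsMinFst (L : Set (ℤ × ℤ)) (x : ℤ) : Prop := (∃ p ∈ L, p.1 = x) ∧ ∀ p ∈ L, x ≤ p.1
def IsMaxFst (L : Set (ℤ × ℤ)) (x : ℤ) : Prop := (∃ p ∈ L, p.1 = x) ∧ ∀ p ∈ L, p.1 ≤ x

/-- The set of exit coordinates (specified by `spec`) of the shadow lines of the `i`-th
iterated skeleton of `P` in direction `d`. -/
def exitSet (spec : Set (ℤ × ℤ) → ℤ → Prop) (d : ℤ × ℤ → ℤ × ℤ → Prop)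
    (P : Set (ℤ × ℤ)) (i : ℕ) : Set ℤ :=
  {v | ∃ j : ℕ, spec (shadowLine d (skeletonIter d P i) (j + 1)) v}

/-- The word read off along one edge in Viennot's construction is the lattice word of the
standard tableau `T`: there is an enumeration `e` of all shadow-line exit coordinates,
in the order prescribed by `lt`, such that the `m`-th exit belongs to a shadow line of the
`i`-th iterated skeleton exactly when the entry `m` of `T` lies in row `i + 1`. -/
def ReadsWord (spec : Set (ℤ × ℤ) → ℤ → Prop) (lt : ℤ → ℤ → Prop)
    (d : ℤ × ℤ → ℤ × ℤ → Prop) (P : Set (ℤ × ℤ)) (T : List (List ℕ)) : Prop :=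
  ∃ e : Fin T.flatten.length → ℤ,
    (∀ a b : Fin T.flatten.length, a < b → lt (e a) (e b)) ∧
    (Set.range e = ⋃ i : ℕ, exitSet spec d P i) ∧
    ∀ (m : Fin T.flatten.length) (i : ℕ), e m ∈ exitSet spec d P i →
      (T.findIdx fun row => row.contains (m.1 + 1)) + 1 = i + 1

/-- `𝒱(𝒫, ↗) = (Pt, Qt)`: the P-word is read bottom-to-top along the right edge
(east exit heights, which are the minimal `y`-coordinates of the lines), the Q-word
left-to-right along the top edge (north exits at minimal `x`-coordinates). -/
def ViennotNE (P : Set (ℤ × ℤ)) (Pt Qt : List (List ℕ)) : Prop :=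
  ReadsWord IsMinSnd (· < ·) dirNE P Pt ∧ ReadsWord IsMinFst (· < ·) dirNE P Qt

/-- `𝒱(𝒫, ↘) = (Pt, Qt)`: P-word left-to-right along the bottom edge, Q-word
top-to-bottom along the right edge. -/
def ViennotSE (P : Set (ℤ × ℤ)) (Pt Qt : List (List ℕ)) : Prop :=
  ReadsWord IsMinFst (· < ·) dirSE P Pt ∧ ReadsWord IsMaxSnd (· > ·) dirSE P Qt

/-- `𝒱(𝒫, ↙) = (Pt, Qt)`: P-word bottom-to-top along the left edge, Q-word
right-to-left along the bottom edge. -/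
def ViennotSW (P : Set (ℤ × ℤ)) (Pt Qt : List (List ℕ)) : Prop :=
  ReadsWord IsMaxSnd (· < ·) dirSW P Pt ∧ ReadsWord IsMaxFst (· > ·) dirSW P Qt

/-- `𝒱(𝒫, ↖) = (Pt, Qt)`: P-word right-to-left along the top edge, Q-word
bottom-to-top along the left edge. -/
def ViennotNW (P : Set (ℤ × ℤ)) (Pt Qt : List (List ℕ)) : Prop :=
  ReadsWord IsMaxFst (· > ·) dirNW P Pt ∧ ReadsWord IsMinSnd (· < ·) dirNW P Qt

/-- The point set `𝒫^NE(ρ)` of the northeast `n × n` block of the permutation matrix of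
`ρ ∈ S_{2n}`, in Cartesian coordinates. -/
def pointsNE (n : ℕ) (f : ℕ → ℕ) : Set (ℤ × ℤ) :=
  {p | ∃ x : ℕ, 1 ≤ x ∧ x ≤ n ∧ n < f x ∧ p = ((f x : ℤ) - n, (n : ℤ) + 1 - x)}

/-! ## Crossings and nestings of perfect matchings -/

/-- The matching `{a, f a}` on `{1, …, N}` has a `k`-crossing:
blocks `{a₁ < b₁}, …, {a_k < b_k}` with `a₁ < ⋯ < a_k < b₁ < ⋯ < b_k`. -/
def HasCrossing (f : ℕ → ℕ) (N k : ℕ) : Prop :=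
  ∃ a b : Fin k → ℕ, StrictMono a ∧ StrictMono b ∧
    (∀ m, 1 ≤ a m ∧ b m ≤ N ∧ f (a m) = b m ∧ a m < b m) ∧
    ∀ m m' : Fin k, a m < b m'

/-- The matching `{a, f a}` on `{1, …, N}` has a `k`-nesting:
blocks `{a₁ < b₁}, …, {a_k < b_k}` with `a₁ < ⋯ < a_k < b_k < ⋯ < b₁`. -/
def HasNesting (f : ℕ → ℕ) (N k : ℕ) : Prop :=
  ∃ a b : Fin k → ℕ, StrictMono a ∧ StrictAnti b ∧
    (∀ m, 1 ≤ a m ∧ b m ≤ N ∧ f (a m) = b m ∧ a m < b m) ∧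
    ∀ m m' : Fin k, a m < b m'

/-! ## Local rules, the promotion–evacuation diagram, and the promotion matrix -/

/-- Partitions are encoded as lists of row lengths (fixed length, padded by zeros). -/
def sortDesc (l : List ℕ) : List ℕ := List.insertionSort (· ≥ ·) l

/-- The sequence `ν + κ - λ` (pointwise). -/
def ruleSeq (lam nu ka : List ℕ) : List ℕ :=
  List.zipWith (fun a b => a - b) (List.zipWith (· + ·) nu ka) lam

/-- The local rule: `μ = sort(ν + κ - λ)`. -/
def localRule (lam nu ka : List ℕ) : List ℕ := sortDesc (ruleSeq lam nu ka)

/-- The decoration of a local rule square: `i` if `ν + κ - λ` fails to be sorted at rows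
`i, i+1` (1-indexed), and `0` if no decoration is present. -/
def decoration (lam nu ka : List ℕ) : ℕ :=
  match (List.range (ruleSeq lam nu ka).length).find? (fun i =>
      decide ((ruleSeq lam nu ka).getD i 0 < (ruleSeq lam nu ka).getD (i + 1) 0)) with
  | some i => i + 1
  | none => 0

/-- Fill in the next row of the promotion–evacuation diagram from the previous row `prev`:
the new row starts with the empty partition at position `s` and continues by local rules. -/
def nextRow (R : ℕ) (prev : ℕ → List ℕ) (s : ℕ) : ℕ → List ℕ
  | 0 => List.replicate R 0
  | x + 1 =>
    if x + 1 ≤ s then List.replicate R 0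
    else localRule (prev x) (prev (x + 1)) (nextRow R prev s x)

/-- The `j`-th row of the promotion–evacuation diagram of `T ∈ SYT(R × C)`, as a function
of the column index (row `0` is the chain of `T`). -/
def PErow (R C : ℕ) (T : ℕ → ℕ → ℕ) : ℕ → ℕ → List ℕ
  | 0 => fun x => (List.range R).map fun i =>
      ((Finset.range C).filter fun j => T i j ≤ min x (R * C)).card
  | j + 1 => nextRow R (PErow R C T j) (j + 1)

/-- For `S = stack(P, Q) ∈ SYT(2r × c)` and `n = r*c`, the `(n+1) × (n+1)` northeast block
of partitions `λ(x, y)` of `PEdiagram(S)` (Cartesian coordinates): `λ(x,y)` is the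
diagram entry in row `n - y`, column `n + x`. -/
def lamBlock (r c : ℕ) (S : ℕ → ℕ → ℕ) (x y : ℕ) : List ℕ :=
  PErow (2 * r) c S (r * c - y) (r * c + x)

/-- The entry of `PM(S)^NE` at Cartesian coordinates `(x, y)`, `1 ≤ x, y ≤ n`: the
decoration of the local rule square with corners `λ(x-1, y-1)`, `λ(x-1, y)`, `λ(x, y-1)`,
`λ(x, y)`. -/
def PMNE (r c : ℕ) (S : ℕ → ℕ → ℕ) (x y : ℕ) : ℕ :=
  decoration (lamBlock r c S (x - 1) y) (lamBlock r c S x y) (lamBlock r c S (x - 1) (y - 1))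

/-- Chain of partitions of a list tableau: shape of the entries `≤ m`. -/
def chainOfL (T : List (List ℕ)) (m : ℕ) : List ℕ :=
  T.map fun row => (row.filter fun a => decide (a ≤ m)).length

/-- Column height `#{i : j < l i}` of a partition. -/
def colHeight (l : List ℕ) (j : ℕ) : ℕ := (l.filter fun a => decide (j < a)).length

/-- Vertical sum `l +' m` of two partitions (stack the columns of `m` onto those of `l`),
computed inside a `rows × cols` bounding box. -/
def vsum (rows cols : ℕ) (l m : List ℕ) : List ℕ :=
  (List.range rows).map fun i =>
    ((List.range cols).filter fun j => decide (i < colHeight l j + colHeight m j)).length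

/-! ## The point sets `S_k` and `S_{kj}` -/

/-- `x_{sj}`: the entry of `Q` in row `s`, column `j` (1-indexed). -/
def xEnt (Q : ℕ → ℕ → ℕ) (s j : ℕ) : ℤ := (Q (s - 1) (j - 1) : ℤ)

/-- `y_{tj}`: the entry of `∂(P)` in row `t`, column `j` (1-indexed). -/
def yEnt (r c : ℕ) (P : ℕ → ℕ → ℕ) (t j : ℕ) : ℤ :=
  (entryL (evacL (toListT r c P)) (t - 1) (j - 1) : ℤ)

def Skj (r c : ℕ) (P Q : ℕ → ℕ → ℕ) (k j : ℕ) : Set (ℤ × ℤ) :=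
  {p | ∃ s t : ℕ, 1 ≤ s ∧ s ≤ r ∧ 1 ≤ t ∧ t ≤ r ∧ s + t - 1 = k ∧
    p = (xEnt Q s j, yEnt r c P t j)}

def Sk (r c : ℕ) (P Q : ℕ → ℕ → ℕ) (k : ℕ) : Set (ℤ × ℤ) :=
  ⋃ j ∈ Set.Icc 1 c, Skj r c P Q k j

/-- A southeast chain of `k` ones in the matrix `U` (rows increase, columns increase),
contained in a rectangle that fully fits into the strictly upper triangular part of the
`N × N` matrix. -/
def HasSEChain (U : ℕ → ℕ → ℕ) (N k : ℕ) : Prop :=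
  ∃ a b : Fin k → ℕ, StrictMono a ∧ StrictMono b ∧ (∀ m, U (a m) (b m) = 1) ∧
    ∃ r₁ r₂ c₁ c₂ : ℕ, 1 ≤ r₁ ∧ r₂ < c₁ ∧ c₂ ≤ N ∧
      ∀ m, r₁ ≤ a m ∧ a m ≤ r₂ ∧ c₁ ≤ b m ∧ b m ≤ c₂

/-- A southwest chain of `k` ones in the matrix `U` (rows increase, columns decrease),
contained in a rectangle that fully fits into the strictly upper triangular part of the
`N × N` matrix. -/
def HasSWChain (U : ℕ → ℕ → ℕ) (N k : ℕ) : Prop :=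
  ∃ a b : Fin k → ℕ, StrictMono a ∧ StrictAnti b ∧ (∀ m, U (a m) (b m) = 1) ∧
    ∃ r₁ r₂ c₁ c₂ : ℕ, 1 ≤ r₁ ∧ r₂ < c₁ ∧ c₂ ≤ N ∧
      ∀ m, r₁ ≤ a m ∧ a m ≤ r₂ ∧ c₁ ≤ b m ∧ b m ≤ c₂

/-! ## The sliding path, row by row -/

theorem exists_slide_down (R C : ℕ) (T : ℕ → ℕ → ℕ) (i b : ℕ) :
    ∃ j, b ≤ j ∧ ¬ ext R C T (i, j + 1) < ext R C T (i + 1, j) := by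
  refine ⟨b + C, by omega, ?_⟩
  have h : ext R C T (i, b + C + 1) = ⊤ := if_neg (by simp; omega)
  simp [h]

open Classical in
/-- The column in which the sliding path of `T` enters row `i`. -/
noncomputable def enterCol (R C : ℕ) (T : ℕ → ℕ → ℕ) : ℕ → ℕ
  | 0 => 0
  | i + 1 => Nat.find (exists_slide_down R C T i (enterCol R C T i))

section Path

variable {R C : ℕ} {T : ℕ → ℕ → ℕ}

theorem enterCol_le_succ (i : ℕ) : enterCol R C T i ≤ enterCol R C T (i + 1) := by
  classical exact (Nat.find_spec (exists_slide_down R C T i (enterCol R C T i))).1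

theorem enterCol_mono {i i' : ℕ} (h : i ≤ i') : enterCol R C T i ≤ enterCol R C T i' :=
  monotone_nat_of_le_succ (fun i => enterCol_le_succ (R := R) (C := C) (T := T) i) h

theorem not_ext_lt_enterCol (i : ℕ) :
    ¬ ext R C T (i, enterCol R C T (i + 1) + 1) < ext R C T (i + 1, enterCol R C T (i + 1)) := by
  classical exact (Nat.find_spec (exists_slide_down R C T i (enterCol R C T i))).2

theorem ext_lt_of_lt_enterCol {i j : ℕ} (h₁ : enterCol R C T i ≤ j)
    (h₂ : j < enterCol R C T (i + 1)) : ext R C T (i, j + 1) < ext R C T (i + 1, j) := by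
  classical
  by_contra h
  exact absurd (Nat.find_min' (exists_slide_down R C T i (enterCol R C T i)) ⟨h₁, h⟩)
    (not_le.2 h₂)

theorem enterCol_lt (hC : 0 < C) (i : ℕ) : enterCol R C T i < C := by
  classical
  induction i with
  | zero => exact hC
  | succ i ih =>
    have : enterCol R C T (i + 1) ≤ C - 1 := by
      refine Nat.find_min' (exists_slide_down R C T i (enterCol R C T i)) ⟨by omega, ?_⟩
      have h : ext R C T (i, C - 1 + 1) = ⊤ := if_neg (by simp; omega)
      simp [h]
    omega

theorem enterCol_last (hR : 0 < R) (hC : 0 < C) : enterCol R C T R = C - 1 := by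
  obtain ⟨R, rfl⟩ := Nat.exists_eq_succ_of_ne_zero hR.ne'
  have h₁ := enterCol_lt (R := R + 1) (T := T) hC (R + 1)
  by_contra hne
  apply not_ext_lt_enterCol (R := R + 1) (C := C) (T := T) R
  have h₂ : ext (R + 1) C T (R + 1, enterCol (R + 1) C T (R + 1)) = ⊤ := if_neg (by simp)
  rw [h₂]
  simp only [ext]
  rw [if_pos ⟨by simp, by simp only [Nat.succ_eq_add_one] at hne; omega⟩]
  exact WithTop.coe_lt_top _

theorem slidePath_add {i j : ℕ} (h₁ : enterCol R C T i ≤ j) (h₂ : j ≤ enterCol R C T (i + 1)) :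
    slidePath R C T (i + j) = (i, j) := by
  have along : ∀ i, slidePath R C T (i + enterCol R C T i) = (i, enterCol R C T i) →
      ∀ d, enterCol R C T i + d ≤ enterCol R C T (i + 1) →
      slidePath R C T (i + (enterCol R C T i + d)) = (i, enterCol R C T i + d) := by
    intro i hi d
    induction d with
    | zero => intro _; exact hi
    | succ d ih =>
      intro hd
      have := ih (by omega)
      have hlt := ext_lt_of_lt_enterCol (R := R) (C := C) (T := T) (i := i)
        (j := enterCol R C T i + d) (by omega) (by omega)
      rw [← add_assoc, ← add_assoc, slidePath, add_assoc, this, nextCell, if_pos hlt]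
      simp [add_assoc]
  have enter : ∀ i, slidePath R C T (i + enterCol R C T i) = (i, enterCol R C T i) := by
    intro i
    induction i with
    | zero => rfl
    | succ i ih =>
      have h := along i ih (enterCol R C T (i + 1) - enterCol R C T i)
        (by have := enterCol_le_succ (R := R) (C := C) (T := T) i; omega)
      rw [Nat.add_sub_cancel' (enterCol_le_succ i)] at h
      rw [Nat.add_right_comm, slidePath, h, nextCell, if_neg (not_ext_lt_enterCol i)]
  have := along i (enter i) (j - enterCol R C T i) (by omega)
  rwa [Nat.add_sub_cancel' h₁] at this

theorem slidePath_sum (k : ℕ) : (slidePath R C T k).1 + (slidePath R C T k).2 = k := by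
  induction k with
  | zero => rfl
  | succ k ih => simp only [slidePath, nextCell]; split_ifs <;> simp <;> omega

theorem slidePath_fst_mono : Monotone fun k => (slidePath R C T k).1 :=
  monotone_nat_of_le_succ fun k => by simp only [slidePath, nextCell]; split_ifs <;> simp

theorem slidePath_eq_iff (i j k : ℕ) : slidePath R C T k = (i, j) ↔
    k = i + j ∧ enterCol R C T i ≤ j ∧ j ≤ enterCol R C T (i + 1) := by
  constructor
  · intro h
    have hk := slidePath_sum (R := R) (C := C) (T := T) k
    rw [h] at hk
    refine ⟨hk.symm, ?_, ?_⟩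
    · by_contra! hlt
      obtain _ | i := i
      · simp [enterCol] at hlt
      have h' := slidePath_add (enterCol_le_succ (R := R) (C := C) (T := T) i) le_rfl
      have := slidePath_fst_mono (R := R) (C := C) (T := T)
        (show k ≤ i + enterCol R C T (i + 1) by simp at hk; omega)
      simp [h, h'] at this
    · by_contra! hlt
      have h' := slidePath_add le_rfl (enterCol_le_succ (R := R) (C := C) (T := T) (i + 1))
      have := slidePath_fst_mono (R := R) (C := C) (T := T)
        (show i + 1 + enterCol R C T (i + 1) ≤ k by simp at hk; omega)
      simp [h, h'] at this
  · rintro ⟨rfl, h₁, h₂⟩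
    exact slidePath_add h₁ h₂

theorem slideInto_eq (hC : 0 < C) {i : ℕ} (hi : i < R) :
    slideInto R C T i = T i (enterCol R C T i) := by
  have h := slidePath_add le_rfl (enterCol_le_succ (R := R) (C := C) (T := T) i)
  have hlt := enterCol_lt (R := R) (T := T) hC i
  have hf : (List.range (R + C - 1)).find? (fun k => decide ((slidePath R C T k).1 = i)) =
      some (i + enterCol R C T i) := by
    rw [List.find?_range_eq_some]
    refine ⟨by simp [h], by simp; omega, fun k hk => ?_⟩
    simp only [Bool.not_eq_true', decide_eq_false_iff_not]
    intro hki
    have hs := slidePath_sum (R := R) (C := C) (T := T) k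
    have := ((slidePath_eq_iff (R := R) (C := C) (T := T) i (slidePath R C T k).2 k).1
      (Prod.ext hki rfl)).2.1
    omega
  rw [slideInto, hf]
  simp [h]

theorem gromotion_last : gromotion R C T (R - 1) (C - 1) = maxEntry R C T + 1 := by
  simp [gromotion]

theorem gromotion_of_not_mem {i j : ℕ} (hij : ¬ (i = R - 1 ∧ j = C - 1))
    (h : ¬ (enterCol R C T i ≤ j ∧ j ≤ enterCol R C T (i + 1))) :
    gromotion R C T i j = T i j := by
  have hf : (List.range (R + C - 2)).find? (fun k => decide (slidePath R C T k = (i, j))) =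
      none := by
    rw [List.find?_range_eq_none]
    intro k _
    simp only [Bool.not_eq_true', decide_eq_false_iff_not, slidePath_eq_iff]
    tauto
  rw [gromotion, if_neg hij, hf]

theorem gromotion_of_mem {i j : ℕ} (hi : i < R) (hj : j < C) (hij : ¬ (i = R - 1 ∧ j = C - 1))
    (h₁ : enterCol R C T i ≤ j) (h₂ : j ≤ enterCol R C T (i + 1)) :
    gromotion R C T i j =
      T (slidePath R C T (i + j + 1)).1 (slidePath R C T (i + j + 1)).2 := by
  have hf : (List.range (R + C - 2)).find? (fun k => decide (slidePath R C T k = (i, j))) =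
      some (i + j) := by
    rw [List.find?_range_eq_some]
    refine ⟨by simp [slidePath_add h₁ h₂], by simp; omega, fun k hk => ?_⟩
    simp only [Bool.not_eq_true', decide_eq_false_iff_not, slidePath_eq_iff]
    omega
  rw [gromotion, if_neg hij, hf]

theorem gromotion_of_lt {i j : ℕ} (hi : i < R) (hC : 0 < C)
    (h₁ : enterCol R C T i ≤ j) (h₂ : j < enterCol R C T (i + 1)) :
    gromotion R C T i j = T i (j + 1) := by
  have hb := enterCol_lt (R := R) (T := T) hC (i + 1)
  rw [gromotion_of_mem hi (by omega) (by omega) h₁ h₂.le, add_assoc,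
    slidePath_add (by omega) (by omega)]

theorem gromotion_enterCol {i : ℕ} (hi : i + 1 < R) (hC : 0 < C) :
    gromotion R C T i (enterCol R C T (i + 1)) = T (i + 1) (enterCol R C T (i + 1)) := by
  have hb := enterCol_lt (R := R) (T := T) hC (i + 1)
  rw [gromotion_of_mem (by omega) (by omega) (by omega) (enterCol_le_succ i) le_rfl,
    add_right_comm, slidePath_add le_rfl (enterCol_le_succ _)]

theorem lt_of_lt_enterCol {i j : ℕ} (hi : i + 1 < R) (hC : 0 < C) (h₁ : enterCol R C T i ≤ j)
    (h₂ : j < enterCol R C T (i + 1)) : T i (j + 1) < T (i + 1) j := by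
  have hb := enterCol_lt (R := R) (T := T) hC (i + 1)
  have h := ext_lt_of_lt_enterCol h₁ h₂
  simp only [ext] at h
  rw [if_pos ⟨by omega, by omega⟩, if_pos ⟨by omega, by omega⟩] at h
  exact_mod_cast h

theorem enterCol_le_apply {i : ℕ} (hi : i + 1 < R) (hC : enterCol R C T (i + 1) + 1 < C) :
    T (i + 1) (enterCol R C T (i + 1)) ≤ T i (enterCol R C T (i + 1) + 1) := by
  have h := not_ext_lt_enterCol (R := R) (C := C) (T := T) i
  simp only [ext] at h
  rw [if_pos ⟨by omega, by omega⟩, if_pos ⟨by omega, by omega⟩] at h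
  exact_mod_cast not_lt.1 h

theorem le_maxEntry {i j : ℕ} (hi : i < R) (hj : j < C) : T i j ≤ maxEntry R C T :=
  Finset.le_sup (s := (Finset.range R) ×ˢ (Finset.range C)) (f := fun p => T p.1 p.2)
    (b := (i, j)) (by simp [hi, hj])

end Path

/-! ## Gromotion of shifted rectangular standard tableaux -/

/-- `T` is a standard filling of the `R × C` rectangle by the numbers `l + 1, …, l + R * C`. -/
structure IsShiftedSYT (R C l : ℕ) (T : ℕ → ℕ → ℕ) : Prop where
  row_succ : ∀ i j, i < R → j + 1 < C → T i j < T i (j + 1)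
  col_succ : ∀ i j, i + 1 < R → j < C → T i j < T (i + 1) j
  bij : Set.BijOn (fun p : ℕ × ℕ => T p.1 p.2) {p : ℕ × ℕ | p.1 < R ∧ p.2 < C}
    (Set.Icc (l + 1) (l + R * C))

theorem IsSYT.isShiftedSYT {R C : ℕ} {T : ℕ → ℕ → ℕ} (h : IsSYT R C T) :
    IsShiftedSYT R C 0 T := ⟨h.1, h.2.1, by simpa using h.2.2⟩

namespace IsShiftedSYT

variable {R C l : ℕ} {T : ℕ → ℕ → ℕ}

theorem row_lt (h : IsShiftedSYT R C l T) {i j j' : ℕ} (hi : i < R) (hj : j < j') (hj' : j' < C) :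
    T i j < T i j' := by
  induction j', hj using Nat.le_induction with
  | base => exact h.row_succ i j hi hj'
  | succ k hk ih => exact (ih (by omega)).trans (h.row_succ i k hi hj')

theorem row_le (h : IsShiftedSYT R C l T) {i j j' : ℕ} (hi : i < R) (hj : j ≤ j') (hj' : j' < C) :
    T i j ≤ T i j' := by
  rcases hj.eq_or_lt with rfl | hj
  · rfl
  · exact (h.row_lt hi hj hj').le

theorem col_lt (h : IsShiftedSYT R C l T) {i i' j : ℕ} (hi : i < i') (hi' : i' < R) (hj : j < C) :
    T i j < T i' j := by
  induction i', hi using Nat.le_induction with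
  | base => exact h.col_succ i j hi' hj
  | succ k hk ih => exact (ih (by omega)).trans (h.col_succ k j hi' hj)

theorem col_le (h : IsShiftedSYT R C l T) {i i' j : ℕ} (hi : i ≤ i') (hi' : i' < R) (hj : j < C) :
    T i j ≤ T i' j := by
  rcases hi.eq_or_lt with rfl | hi
  · rfl
  · exact (h.col_lt hi hi' hj).le

theorem mem_Icc (h : IsShiftedSYT R C l T) {i j : ℕ} (hi : i < R) (hj : j < C) :
    l + 1 ≤ T i j ∧ T i j ≤ l + R * C :=
  h.bij.mapsTo (show (i, j) ∈ {p : ℕ × ℕ | p.1 < R ∧ p.2 < C} from ⟨hi, hj⟩)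

theorem inj (h : IsShiftedSYT R C l T) {i j i' j' : ℕ} (hi : i < R) (hj : j < C) (hi' : i' < R)
    (hj' : j' < C) (he : T i j = T i' j') : i = i' ∧ j = j' :=
  Prod.ext_iff.1 (h.bij.injOn (show (i, j) ∈ {p : ℕ × ℕ | p.1 < R ∧ p.2 < C} from ⟨hi, hj⟩)
    (show (i', j') ∈ {p : ℕ × ℕ | p.1 < R ∧ p.2 < C} from ⟨hi', hj'⟩) he)

theorem exists_eq (h : IsShiftedSYT R C l T) {x : ℕ} (h₁ : l + 1 ≤ x) (h₂ : x ≤ l + R * C) :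
    ∃ i j, i < R ∧ j < C ∧ T i j = x := by
  obtain ⟨⟨i, j⟩, ⟨hi, hj⟩, hx⟩ := h.bij.surjOn ⟨h₁, h₂⟩
  exact ⟨i, j, hi, hj, hx⟩

theorem apply_zero_zero (h : IsShiftedSYT R C l T) (hR : 0 < R) (hC : 0 < C) :
    T 0 0 = l + 1 := by
  obtain ⟨i, j, hi, hj, hx⟩ := h.exists_eq le_rfl
    (by have := Nat.mul_pos hR hC; omega)
  have h₁ := h.row_le hR (Nat.zero_le j) hj
  have h₂ := h.col_le (Nat.zero_le i) hi hj
  have := (h.mem_Icc hR hC).1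
  omega

theorem maxEntry_eq (h : IsShiftedSYT R C l T) (hR : 0 < R) (hC : 0 < C) :
    maxEntry R C T = l + R * C := by
  apply le_antisymm
  · refine Finset.sup_le fun p hp => ?_
    simp only [Finset.mem_product, Finset.mem_range] at hp
    exact (h.mem_Icc hp.1 hp.2).2
  · obtain ⟨i, j, hi, hj, hx⟩ := h.exists_eq (x := l + R * C)
      (by have := Nat.mul_pos hR hC; omega) le_rfl
    exact hx ▸ le_maxEntry hi hj

/-- The origin of the entry that occupies a given cell after gromotion. -/
theorem gromotion_cases (h : IsShiftedSYT R C l T) {i j : ℕ} (hi : i < R) (hj : j < C) :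
    (i = R - 1 ∧ j = C - 1 ∧ gromotion R C T i j = l + R * C + 1) ∨
    (enterCol R C T i ≤ j ∧ j < enterCol R C T (i + 1) ∧ j + 1 < C ∧
      gromotion R C T i j = T i (j + 1)) ∨
    (j = enterCol R C T (i + 1) ∧ i + 1 < R ∧ gromotion R C T i j = T (i + 1) j) ∨
    ((j < enterCol R C T i ∨ enterCol R C T (i + 1) < j) ∧ gromotion R C T i j = T i j) := by
  have hC : 0 < C := by omega
  by_cases hc : i = R - 1 ∧ j = C - 1
  · left
    obtain ⟨rfl, rfl⟩ := hc
    exact ⟨rfl, rfl, by rw [gromotion_last, h.maxEntry_eq (by omega) hC]⟩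
  right
  by_cases h₁ : enterCol R C T i ≤ j ∧ j ≤ enterCol R C T (i + 1)
  · rcases h₁.2.lt_or_eq with h₂ | h₂
    · have := enterCol_lt (R := R) (T := T) hC (i + 1)
      exact Or.inl ⟨h₁.1, h₂, by omega, gromotion_of_lt hi hC h₁.1 h₂⟩
    · right; left
      have hiR : i + 1 < R := by
        by_contra hiR
        have hiR : i + 1 = R := by omega
        have := enterCol_last (T := T) (by omega : 0 < R) hC
        rw [hiR, this] at h₂
        omega
      refine ⟨h₂, hiR, ?_⟩
      rw [h₂, gromotion_enterCol hiR hC]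
  · exact Or.inr (Or.inr ⟨by omega, gromotion_of_not_mem hc h₁⟩)

theorem le_gromotion (h : IsShiftedSYT R C l T) {i j : ℕ} (hi : i < R) (hj : j < C) :
    T i j ≤ gromotion R C T i j := by
  rcases h.gromotion_cases hi hj with ⟨-, -, e⟩ | ⟨-, -, h', e⟩ | ⟨-, h', e⟩ | ⟨-, e⟩ <;> rw [e]
  · exact (h.mem_Icc hi hj).2.trans (Nat.le_succ _)
  · exact (h.row_succ i j hi h').le
  · exact (h.col_succ i j h' hj).le

theorem enterCol_lt_apply (h : IsShiftedSYT R C l T) {i : ℕ} (hi : i + 1 < R)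
    (hC : enterCol R C T (i + 1) + 1 < C) :
    T (i + 1) (enterCol R C T (i + 1)) < T i (enterCol R C T (i + 1) + 1) := by
  refine lt_of_le_of_ne (enterCol_le_apply hi hC) fun he => ?_
  have := h.inj hi (by omega) (by omega) hC he
  omega

theorem apply_enterCol_lt (h : IsShiftedSYT R C l T) (hC : 0 < C) {i : ℕ} (hi : i + 1 < R) :
    T i (enterCol R C T i) < T (i + 1) (enterCol R C T (i + 1)) :=
  (h.row_le (by omega) (enterCol_le_succ i) (enterCol_lt hC _)).trans_lt
    (h.col_succ _ _ hi (enterCol_lt hC _))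

theorem gromotion (h : IsShiftedSYT R C l T) (hR : 0 < R) (hC : 0 < C) :
    IsShiftedSYT R C (l + 1) (gromotion R C T) := by
  have row : ∀ i j, i < R → j + 1 < C →
      PromRS.gromotion R C T i j < PromRS.gromotion R C T i (j + 1) := by
    intro i j hi hj
    have h₀ := h.row_succ i j hi hj
    have h₁ := h.le_gromotion hi hj
    rcases h.gromotion_cases hi (show j < C by omega) with
      ⟨-, e', e⟩ | ⟨b₁, b₂, -, e⟩ | ⟨b₁, hiR, e⟩ | ⟨b, e⟩
    · omega
    · rw [e]
      rcases h.gromotion_cases hi hj with ⟨-, -, e'⟩ | ⟨-, -, h', e'⟩ | ⟨-, h', e'⟩ | ⟨b', e'⟩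
      · have := (h.mem_Icc hi hj).2
        omega
      · rw [e']; exact h.row_succ _ _ hi h'
      · rw [e']; exact h.col_succ _ _ h' hj
      · omega
    · have h₂ := enterCol_lt_apply h hiR (by omega)
      rw [← b₁] at h₂
      omega
    · omega
  have col : ∀ i j, i + 1 < R → j < C →
      PromRS.gromotion R C T i j < PromRS.gromotion R C T (i + 1) j := by
    intro i j hi hj
    have h₀ := h.col_succ i j hi hj
    have h₁ := h.le_gromotion hi hj
    rcases h.gromotion_cases (show i < R by omega) hj with
      ⟨e', -, e⟩ | ⟨b₁, b₂, -, e⟩ | ⟨b₁, -, e⟩ | ⟨b, e⟩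
    · omega
    · have := lt_of_lt_enterCol hi hC b₁ b₂
      omega
    · rw [e]
      have hb := enterCol_le_succ (R := R) (C := C) (T := T) (i + 1)
      rcases h.gromotion_cases hi hj with ⟨-, -, e'⟩ | ⟨-, -, h', e'⟩ | ⟨-, h', e'⟩ | ⟨b', e'⟩
      · have := (h.mem_Icc hi hj).2
        omega
      · rw [e']; exact h.row_succ _ _ hi h'
      · rw [e']; exact h.col_succ _ _ h' hj
      · omega
    · omega
  refine ⟨row, col, ?_⟩
  have hset : {p : ℕ × ℕ | p.1 < R ∧ p.2 < C} =
      (((Finset.range R) ×ˢ (Finset.range C) : Finset (ℕ × ℕ)) : Set (ℕ × ℕ)) := by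
    ext p; simp
  have maps : Set.MapsTo (fun p : ℕ × ℕ => PromRS.gromotion R C T p.1 p.2)
      {p : ℕ × ℕ | p.1 < R ∧ p.2 < C} (Set.Icc (l + 1 + 1) (l + 1 + R * C)) := by
    rintro ⟨i, j⟩ ⟨hi, hj⟩
    simp only at hi hj
    have hmin : ∀ i j, i < R → j < C → 0 < i + j → l + 1 < T i j := by
      intro i j hi hj hij
      refine lt_of_le_of_ne (h.mem_Icc hi hj).1 fun he => ?_
      have := h.inj hR hC hi hj ((h.apply_zero_zero hR hC).trans he)
      omega
    simp only [Set.mem_Icc]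
    rcases h.gromotion_cases hi hj with ⟨-, -, e⟩ | ⟨-, -, h', e⟩ | ⟨-, h', e⟩ | ⟨b, e⟩ <;> rw [e]
    · have := Nat.mul_pos hR hC
      omega
    · have := h.mem_Icc hi h'
      have := hmin i (j + 1) hi h' (by omega)
      omega
    · have := h.mem_Icc h' hj
      have := hmin (i + 1) j h' hj (by omega)
      omega
    · have := h.mem_Icc hi hj
      have : 0 < i + j := by
        by_contra h0
        obtain ⟨rfl, rfl⟩ : i = 0 ∧ j = 0 := by omega
        simp [enterCol] at b
      have := hmin i j hi hj this
      omega
  have inj : Set.InjOn (fun p : ℕ × ℕ => PromRS.gromotion R C T p.1 p.2)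
      {p : ℕ × ℕ | p.1 < R ∧ p.2 < C} := by
    rintro ⟨i, j⟩ ⟨hi, hj⟩ ⟨i', j'⟩ ⟨hi', hj'⟩ he
    simp only at hi hj hi' hj' he
    rw [Prod.mk.injEq]
    have m₁ := enterCol_le_succ (R := R) (C := C) (T := T) i
    have m₂ := enterCol_le_succ (R := R) (C := C) (T := T) i'
    have m₃ := enterCol_le_succ (R := R) (C := C) (T := T) (i + 1)
    have m₄ := enterCol_le_succ (R := R) (C := C) (T := T) (i' + 1)
    rcases h.gromotion_cases hi hj with
      ⟨a₁, a₂, e⟩ | ⟨a₁, a₂, a₃, e⟩ | ⟨a₁, a₂, e⟩ | ⟨a₁, e⟩ <;>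
    rcases h.gromotion_cases hi' hj' with
      ⟨c₁, c₂, e'⟩ | ⟨c₁, c₂, c₃, e'⟩ | ⟨c₁, c₂, e'⟩ | ⟨c₁, e'⟩ <;>
    rw [e, e'] at he
    · omega
    · have := (h.mem_Icc hi' c₃).2; omega
    · have := (h.mem_Icc c₂ hj').2; omega
    · have := (h.mem_Icc hi' hj').2; omega
    · have := (h.mem_Icc hi a₃).2; omega
    · have := h.inj hi a₃ hi' c₃ he; omega
    · obtain ⟨rfl, rfl⟩ := h.inj hi a₃ c₂ hj' he; omega
    · obtain ⟨rfl, rfl⟩ := h.inj hi a₃ hi' hj' he; omega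
    · have := (h.mem_Icc a₂ hj).2; omega
    · obtain ⟨rfl, rfl⟩ := h.inj a₂ hj hi' c₃ he; omega
    · have := h.inj a₂ hj c₂ hj' he; omega
    · obtain ⟨rfl, rfl⟩ := h.inj a₂ hj hi' hj' he; omega
    · have := (h.mem_Icc hi hj).2; omega
    · obtain ⟨rfl, rfl⟩ := h.inj hi hj hi' c₃ he; omega
    · obtain ⟨rfl, rfl⟩ := h.inj hi hj c₂ hj' he; omega
    · exact h.inj hi hj hi' hj' he
  refine ⟨maps, inj, ?_⟩
  rw [hset] at maps inj ⊢
  rw [← Finset.coe_Icc] at maps ⊢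
  exact Finset.surjOn_of_injOn_of_card_le _ maps inj (by simp)

theorem iterate_gromotion (h : IsShiftedSYT R C l T) (hR : 0 < R) (hC : 0 < C) (k : ℕ) :
    IsShiftedSYT R C (l + k) ((PromRS.gromotion R C)^[k] T) := by
  induction k with
  | zero => exact h
  | succ k ih => rw [Function.iterate_succ_apply']; exact ih.gromotion hR hC

end IsShiftedSYT

/-! ## The columns of the lower half of a stacked tableau during gromotion -/

/-- In column `k` of `T` the first `h k` entries are at most `r * c`; they are followed by the
`k`-th column of `Q` raised by `r * c`, and then by entries exceeding `2 * (r * c)`. -/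
structure HasRaisedColumns (r c : ℕ) (Q : ℕ → ℕ → ℕ) (h : ℕ → ℕ) (T : ℕ → ℕ → ℕ) : Prop where
  height_le : ∀ k < c, h k ≤ r
  low : ∀ k < c, ∀ i < h k, T i k ≤ r * c
  mid : ∀ k < c, ∀ i < r, T (h k + i) k = r * c + Q i k
  high : ∀ k < c, ∀ i < 2 * r, h k + r ≤ i → 2 * (r * c) < T i k

theorem hasRaisedColumns_stack {r c : ℕ} {P Q : ℕ → ℕ → ℕ} (hP : IsSYT r c P) :
    HasRaisedColumns r c Q (fun _ => r) (stack r c P Q) where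
  height_le _ _ := le_rfl
  low k hk i hi := by
    have := (hP.isShiftedSYT.mem_Icc hi hk).2
    simp only [stack, if_pos hi]
    omega
  mid k _ i _ := by simp [stack, add_comm]
  high k _ i hi hi' := by omega

theorem isShiftedSYT_stack {r c : ℕ} {P Q : ℕ → ℕ → ℕ} (hP : IsSYT r c P) (hQ : IsSYT r c Q) :
    IsShiftedSYT (2 * r) c 0 (stack r c P Q) := by
  have hP := hP.isShiftedSYT
  have hQ := hQ.isShiftedSYT
  refine ⟨fun i j hi hj => ?_, fun i j hi hj => ?_, ?_, ?_, ?_⟩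
  · simp only [stack]
    split_ifs with h
    · exact hP.row_succ i j h hj
    · have := hQ.row_succ (i - r) j (by omega) hj
      omega
  · simp only [stack]
    split_ifs with h h' h'
    · exact hP.col_succ i j h' hj
    · have := (hP.mem_Icc h hj).2
      have := (hQ.mem_Icc (i := i + 1 - r) (by omega) hj).1
      omega
    · omega
    · have := hQ.col_succ (i - r) j (by omega) hj
      rw [show i - r + 1 = i + 1 - r by omega] at this
      omega
  · rintro ⟨i, j⟩ ⟨hi, hj⟩
    simp only at hi hj
    simp only [stack, Set.mem_Icc, mul_assoc]
    split_ifs with h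
    · have := hP.mem_Icc h hj
      omega
    · have := hQ.mem_Icc (i := i - r) (by omega) hj
      omega
  · rintro ⟨i, j⟩ ⟨hi, hj⟩ ⟨i', j'⟩ ⟨hi', hj'⟩ he
    simp only at hi hj hi' hj'
    simp only [stack] at he
    rw [Prod.mk.injEq]
    split_ifs at he with h h' h'
    · exact hP.inj h hj h' hj' he
    · have := hP.mem_Icc h hj
      have := hQ.mem_Icc (i := i' - r) (by omega) hj'
      omega
    · have := hP.mem_Icc h' hj'
      have := hQ.mem_Icc (i := i - r) (by omega) hj
      omega
    · have := hQ.inj (i := i - r) (i' := i' - r) (by omega) hj (by omega) hj'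
        (Nat.add_right_cancel he)
      omega
  · intro x hx
    rw [Set.mem_Icc, mul_assoc] at hx
    by_cases h : x ≤ r * c
    · obtain ⟨i, j, hi, hj, e⟩ := hP.exists_eq (x := x) (by omega) (by omega)
      refine ⟨(i, j), ⟨?_, hj⟩, ?_⟩
      · simp only; omega
      · simp [stack, hi, e]
    · obtain ⟨i, j, hi, hj, e⟩ := hQ.exists_eq (x := x - r * c) (by omega) (by omega)
      refine ⟨(r + i, j), ⟨?_, hj⟩, ?_⟩
      · simp only; omega
      · simp only [stack, add_tsub_cancel_left, e]
        rw [if_neg (by omega)]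
        omega

namespace HasRaisedColumns

variable {r c l : ℕ} {Q T : ℕ → ℕ → ℕ} {h : ℕ → ℕ}

theorem mid_of_le (H : HasRaisedColumns r c Q h T) {i k : ℕ} (hk : k < c) (h₁ : h k ≤ i)
    (h₂ : i < h k + r) : T i k = r * c + Q (i - h k) k := by
  have := H.mid k hk (i - h k) (by omega)
  rwa [Nat.add_sub_cancel' h₁] at this

theorem lt_of_le (H : HasRaisedColumns r c Q h T) (hQ : IsSYT r c Q) {i k : ℕ} (hi : i < 2 * r)
    (hk : k < c) (hik : h k ≤ i) : r * c < T i k := by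
  by_cases h' : i < h k + r
  · rw [H.mid_of_le hk hik h']
    have := (hQ.isShiftedSYT.mem_Icc (i := i - h k) (by omega) hk).1
    omega
  · have := H.high k hk i hi (by omega)
    omega

theorem lt_height (H : HasRaisedColumns r c Q h T) (hQ : IsSYT r c Q) {i k : ℕ} (hi : i < 2 * r)
    (hk : k < c) (hik : T i k ≤ r * c) : i < h k := by
  by_contra h'
  have := H.lt_of_le hQ hi hk (by omega)
  omega

theorem height_anti (H : HasRaisedColumns r c Q h T) (hQ : IsSYT r c Q)
    (hT : IsShiftedSYT (2 * r) c l T) {j j' : ℕ} (hj : j ≤ j') (hj' : j' < c) : h j' ≤ h j := by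
  by_contra hlt
  have h₁ := H.height_le j' hj'
  have h₂ := H.low j' hj' (h j) (by omega)
  have h₃ := H.lt_of_le hQ (by omega) (by omega) (le_refl (h j))
  have h₄ := hT.row_le (i := h j) (by omega) hj hj'
  omega

/-- Right of a column whose raised part starts `a` rows lower, the entries of the raised part
are larger. -/
theorem lt_apply_succ (H : HasRaisedColumns r c Q h T) (hQ : IsSYT r c Q) {i a k : ℕ}
    (hi : i < 2 * r) (hk : k + 1 < c) (ha : a < r) (hai : h (k + 1) + a ≤ i) :
    r * c + Q a k < T i (k + 1) := by
  by_cases h' : i < h (k + 1) + r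
  · rw [H.mid_of_le hk (by omega) h']
    have h₁ := hQ.isShiftedSYT.row_succ a k ha hk
    have h₂ := hQ.isShiftedSYT.col_le (i := a) (i' := i - h (k + 1)) (by omega) (by omega) hk
    omega
  · have := H.high (k + 1) hk i hi (by omega)
    have := (hQ.isShiftedSYT.mem_Icc ha (show k < c by omega)).2
    omega

/-- A gromotion slide leaves the upper part in a row `e`, and then moves up the part of one
column of `T` that consists of entries of `Q`. -/
theorem exists_slide (H : HasRaisedColumns r c Q h T) (hQ : IsSYT r c Q)
    (hT : IsShiftedSYT (2 * r) c l T) (hl : l < r * c) :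
    ∃ e k, e < r ∧ k < c ∧ h k = e + 1 ∧ T e (enterCol (2 * r) c T e) ≤ r * c ∧
      (k + 1 < c → h (k + 1) ≤ e) ∧ T e k ≤ r * c ∧ enterCol (2 * r) c T e ≤ k ∧
      ∀ i, e < i → i ≤ e + r → enterCol (2 * r) c T i = k := by
  have hr : 0 < r := Nat.pos_of_mul_pos_right (by omega : 0 < r * c)
  have hc : 0 < c := Nat.pos_of_mul_pos_left (by omega : 0 < r * c)
  have hb := fun i => enterCol_lt (R := 2 * r) (T := T) hc i
  have hex : ∃ i, r * c < T i (enterCol (2 * r) c T i) :=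
    ⟨r, H.lt_of_le hQ (by omega) (hb r) (H.height_le _ (hb r))⟩
  classical
  obtain ⟨e, he⟩ : ∃ e, Nat.find hex = e + 1 := by
    refine Nat.exists_eq_succ_of_ne_zero fun h0 => ?_
    have h₁ := Nat.find_spec hex
    rw [h0] at h₁
    change r * c < T 0 0 at h₁
    rw [hT.apply_zero_zero (by omega) hc] at h₁
    omega
  have hpe : T e (enterCol (2 * r) c T e) ≤ r * c :=
    not_lt.1 (Nat.find_min hex (by omega : e < Nat.find hex))
  have hpe' : r * c < T (e + 1) (enterCol (2 * r) c T (e + 1)) := he ▸ Nat.find_spec hex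
  have her : e < r := by
    have : Nat.find hex ≤ r :=
      Nat.find_min' hex (H.lt_of_le hQ (by omega) (hb r) (H.height_le _ (hb r)))
    omega
  have hk := hb (e + 1)
  have hek : enterCol (2 * r) c T e ≤ enterCol (2 * r) c T (e + 1) := enterCol_le_succ e
  have hlow : ∀ j, enterCol (2 * r) c T e ≤ j → j ≤ enterCol (2 * r) c T (e + 1) →
      T e j ≤ r * c := by
    intro j hj
    induction j, hj using Nat.le_induction with
    | base => exact fun _ => hpe
    | succ j hj ih =>
      intro hj'
      have h₁ := ih (by omega)
      have h₂ := lt_of_lt_enterCol (i := e) (by omega) hc hj (by omega)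
      by_contra h₃
      have h₄ := H.lt_height hQ (by omega) (by omega) h₁
      have h₅ : h j = e + 1 := by
        by_contra h₆
        have := H.low j (by omega) (e + 1) (by omega)
        omega
      have h₆ := H.mid j (by omega) 0 hr
      rw [h₅] at h₆
      have h₇ : h (j + 1) ≤ e := by
        by_contra h₈
        have := H.low (j + 1) (by omega) e (by omega)
        omega
      have := H.lt_apply_succ hQ (i := e) (a := 0) (k := j) (by omega) (by omega) hr (by omega)
      simp only [add_zero] at h₆
      omega
  generalize hkd : enterCol (2 * r) c T (e + 1) = k at hk hek hlow hpe'
  have hTk := hlow k hek le_rfl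
  have hhk : h k = e + 1 := by
    have := H.lt_height hQ (by omega) hk hTk
    by_contra h₆
    have := H.low k hk (e + 1) (by omega)
    omega
  have hk1 : k + 1 < c → h (k + 1) ≤ e := by
    intro hk1
    have := hT.enterCol_lt_apply (i := e) (by omega) (by omega)
    rw [hkd] at this
    by_contra h₈
    have := H.low (k + 1) (by omega) e (by omega)
    omega
  refine ⟨e, k, her, hk, hhk, hpe, hk1, hTk, hek, fun i hi => ?_⟩
  induction i, hi using Nat.le_induction with
  | base => exact fun _ => hkd
  | succ i hi ih =>
    intro hi'
    have h₁ := ih (by omega)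
    have h₂ := enterCol_le_succ (R := 2 * r) (C := c) (T := T) i
    by_contra h₃
    have h₄ := lt_of_lt_enterCol (T := T) (i := i) (j := k) (by omega) hc h₁.le (by omega)
    have h₅ := hb (i + 1)
    have h₆ := H.lt_apply_succ hQ (i := i) (a := i - e) (k := k) (by omega) (by omega) (by omega)
      (by have := hk1 (show k + 1 < c by omega); omega)
    have h₇ := H.mid k hk (i - e) (by omega)
    rw [show h k + (i - e) = i + 1 by omega] at h₇
    omega

theorem gromotion (H : HasRaisedColumns r c Q h T) (hQ : IsSYT r c Q)
    (hT : IsShiftedSYT (2 * r) c l T) {e k : ℕ} (he : e < r) (hk : k < c) (hhk : h k = e + 1)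
    (hk1 : k + 1 < c → h (k + 1) ≤ e) (hTk : T e k ≤ r * c) (hek : enterCol (2 * r) c T e ≤ k)
    (hb : ∀ i, e < i → i ≤ e + r → enterCol (2 * r) c T i = k) :
    HasRaisedColumns r c Q (Function.update h k e) (gromotion (2 * r) c T) := by
  have hc : 0 < c := by omega
  have hbe := hb (e + 1) (by omega) (by omega)
  have mono := fun {i i' : ℕ} (hii : i ≤ i') => enterCol_mono (R := 2 * r) (C := c) (T := T) hii
  have hright : ∀ j, k < j → j < c → h j ≤ e := fun j hkj hj =>
    (H.height_anti hQ hT hkj hj).trans (hk1 (by omega))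
  have hleft : ∀ j, j ≤ k → e + 1 ≤ h j := fun j hj => hhk ▸ H.height_anti hQ hT hj hk
  have hlow : ∀ i j, i ≤ e → j ≤ k → T i j ≤ r * c := fun i j hi hj =>
    ((hT.col_le hi (by omega) (by omega)).trans (hT.row_le (by omega) hj hk)).trans hTk
  have hup : ∀ i, i ≤ e → enterCol (2 * r) c T (i + 1) ≤ k := fun i hi =>
    hbe ▸ mono (by omega)
  have hdown : ∀ i, e < i → k ≤ enterCol (2 * r) c T i := fun i hi => hbe ▸ mono hi
  constructor
  · intro j hj
    rcases eq_or_ne j k with rfl | hjk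
    · simp only [Function.update_self]; omega
    · rw [Function.update_of_ne hjk]; exact H.height_le j hj
  · intro j hj i hi
    rcases eq_or_ne j k with rfl | hjk
    · rw [Function.update_self] at hi
      rcases hT.gromotion_cases (i := i) (by omega) hj with
        ⟨h₁, -, -⟩ | ⟨-, h₁, -, -⟩ | ⟨-, -, e'⟩ | ⟨-, e'⟩
      · omega
      · have := hup i (by omega)
        omega
      · rw [e']; exact hlow _ _ hi le_rfl
      · rw [e']; exact hlow _ _ (by omega) le_rfl
    · rw [Function.update_of_ne hjk] at hi
      have hhj := H.height_le j hj
      have hgt : ¬ (e < i ∧ k < j) := fun ⟨h₁, h₂⟩ => by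
        have := hright j h₂ hj
        omega
      rcases hT.gromotion_cases (i := i) (by omega) hj with
        ⟨h₁, -, -⟩ | ⟨h₁, h₂, h₃, e'⟩ | ⟨h₁, h₂, e'⟩ | ⟨-, e'⟩
      · omega
      · rw [e']
        by_cases hie : i ≤ e
        · have := hup i hie
          exact hlow _ _ hie (by omega)
        · have := hdown i (by omega)
          omega
      · rw [e']
        rcases lt_trichotomy i e with hie | hie | hie
        · exact hlow _ _ hie (h₁ ▸ hup i hie.le)
        · subst hie
          omega
        · have := hdown (i + 1) (by omega)
          omega
      · rw [e']; exact H.low j hj i hi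
  · intro j hj i hi
    rcases eq_or_ne j k with rfl | hjk
    · have hbi := hb (e + i + 1) (by omega) (by omega)
      rw [Function.update_self]
      have := gromotion_enterCol (R := 2 * r) (T := T) (i := e + i) (by omega) hc
      rw [hbi] at this
      rw [this, ← H.mid j hj i hi, hhk, add_right_comm]
    · rw [Function.update_of_ne hjk, ← H.mid j hj i hi]
      have hhj := H.height_le j hj
      rcases hT.gromotion_cases (i := h j + i) (by omega) hj with
        ⟨h₁, h₂, -⟩ | ⟨h₁, h₂, h₃, e'⟩ | ⟨h₁, h₂, e'⟩ | ⟨-, e'⟩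
      · have := hright j (by omega) hj
        omega
      · exfalso
        by_cases hie : h j + i ≤ e
        · have := hup _ hie
          have := hleft j (by omega)
          omega
        · have h₄ := hdown (h j + i) (by omega)
          have := hright j (by omega) hj
          have := hb (h j + i + 1) (by omega) (by omega)
          omega
      · exfalso
        rcases lt_trichotomy (h j + i) e with hie | hie | hie
        · have := hup _ hie.le
          have := hleft j (by omega)
          omega
        · rw [hie] at h₁
          omega
        · have := hdown (h j + i + 1) (by omega)
          have := hright j (by omega) hj
          have := hb (h j + i + 1) (by omega) (by omega)
          omega
      · exact e'
  · intro j hj i hi hi'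
    rcases eq_or_ne j k with rfl | hjk
    · rw [Function.update_self] at hi'
      rcases hi'.eq_or_lt with rfl | hlt
      · have hbi := hb (e + r) (by omega) le_rfl
        have := mono (Nat.le_succ (e + r))
        rcases hT.gromotion_cases hi hj with
          ⟨-, -, e'⟩ | ⟨-, -, h₁, e'⟩ | ⟨-, h₁, e'⟩ | ⟨h₁, -⟩
        · rw [e', mul_assoc]; omega
        · rw [e']
          have := hk1 h₁
          exact H.high _ h₁ _ hi (by omega)
        · rw [e']; exact H.high _ hj _ h₁ (by omega)
        · simp only [Nat.succ_eq_add_one] at this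
          omega
      · exact (H.high j hj i hi (by omega)).trans_le (hT.le_gromotion hi hj)
    · rw [Function.update_of_ne hjk] at hi'
      exact (H.high j hj i hi (by omega)).trans_le (hT.le_gromotion hi hj)

end HasRaisedColumns

/-! ## A last-passage functional on interlacing arrays -/

/-- Interlacing arrays with values in `[m, n]`, constant from row `k` on. -/
structure IsInterlacing (k m n : ℕ) (t : ℕ → ℕ → ℕ) : Prop where
  le_apply : ∀ a i, m ≤ t a i
  apply_le : ∀ a i, t a i ≤ n
  anti : ∀ a i, t a (i + 1) ≤ t a i
  diag : ∀ a i, t a i ≤ t (a + 1) (i + 1)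
  eq_of_le : ∀ a i, k ≤ a → t a i = n

/-- The weight collected in `r` rows along a path that leaves row `i` at time `x i` and enters it
at time `x (i + 1)`. -/
def pathWeight (r : ℕ) (N : ℕ → ℕ → ℤ) (x : ℕ → ℕ) : ℤ :=
  ∑ i ∈ Finset.range r, (N i (x i) - N i (x (i + 1)))

/-- Every `k`-tuple of paths for `N` is matched by a tuple for `N'` of at least the same weight. -/
def Dominated (r k m n : ℕ) (N N' : ℕ → ℕ → ℤ) : Prop :=
  ∀ t, IsInterlacing k m n t → ∃ t', IsInterlacing k m n t' ∧
    ∑ a ∈ Finset.range k, pathWeight r N (t a) ≤ ∑ a ∈ Finset.range k, pathWeight r N' (t' a)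

theorem Dominated.trans {r k m n : ℕ} {N N' N'' : ℕ → ℕ → ℤ} (h : Dominated r k m n N N')
    (h' : Dominated r k m n N' N'') : Dominated r k m n N N'' := fun t ht =>
  let ⟨_, ht₁, hle₁⟩ := h t ht
  let ⟨t₂, ht₂, hle₂⟩ := h' _ ht₁
  ⟨t₂, ht₂, hle₁.trans hle₂⟩

theorem dominated_of_add_const {r k m n : ℕ} {N N' : ℕ → ℕ → ℤ} (κ : ℕ → ℤ)
    (h : ∀ i < r, ∀ s, m ≤ s → s ≤ n → N' i s = N i s + κ i) : Dominated r k m n N N' := by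
  refine fun t ht => ⟨t, ht, Finset.sum_le_sum fun a _ => Finset.sum_le_sum fun i hi => ?_⟩
  have hi := Finset.mem_range.1 hi
  rw [h i hi _ (ht.le_apply a i) (ht.apply_le a i),
    h i hi _ (ht.le_apply a (i + 1)) (ht.apply_le a (i + 1))]
  omega

theorem pathWeight_update {r q : ℕ} (hq : q + 1 < r) (N : ℕ → ℕ → ℤ) (x : ℕ → ℕ) (v : ℕ) :
    pathWeight r N (Function.update x (q + 1) v) = pathWeight r N x +
      (N q (x (q + 1)) - N (q + 1) (x (q + 1))) - (N q v - N (q + 1) v) := by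
  rw [add_sub_assoc, ← sub_eq_iff_eq_add', pathWeight, pathWeight, ← Finset.sum_sub_distrib,
    Finset.sum_eq_add_of_mem q (q + 1) (by simp; omega) (by simpa using hq) (by omega)]
  · simp only [Function.update_self, Function.update_of_ne (show q ≠ q + 1 by omega),
      Function.update_of_ne (show q + 1 + 1 ≠ q + 1 by omega)]
    ring
  · rintro i - ⟨h₁, h₂⟩
    rw [Function.update_of_ne h₂, Function.update_of_ne (by omega)]
    ring

theorem sum_pathWeight_update {r q k a : ℕ} (hq : q + 1 < r) (ha : a < k) (N : ℕ → ℕ → ℤ)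
    (t : ℕ → ℕ → ℕ) (v : ℕ) :
    ∑ a' ∈ Finset.range k,
        pathWeight r N (Function.update t a (Function.update (t a) (q + 1) v) a') =
      ∑ a' ∈ Finset.range k, pathWeight r N (t a') +
        (N q (t a (q + 1)) - N (q + 1) (t a (q + 1))) - (N q v - N (q + 1) v) := by
  rw [add_sub_assoc, ← sub_eq_iff_eq_add', ← Finset.sum_sub_distrib,
    Finset.sum_eq_single_of_mem a (by simpa using ha)]
  · rw [Function.update_self, pathWeight_update hq]
    ring
  · intro b _ hb
    rw [Function.update_of_ne hb, sub_self]

theorem IsInterlacing.update {k m n : ℕ} {t : ℕ → ℕ → ℕ} (ht : IsInterlacing k m n t)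
    {a q v : ℕ} (ha : a < k) (hmv : m ≤ v) (hvn : v ≤ n) (h₁ : t a (q + 1 + 1) ≤ v) (h₂ : v ≤ t a q)
    (h₃ : v ≤ t (a + 1) (q + 1 + 1)) (h₄ : ∀ b, b + 1 = a → t b q ≤ v) :
    IsInterlacing k m n (Function.update t a (Function.update (t a) (q + 1) v)) := by
  have hval : ∀ b i, Function.update t a (Function.update (t a) (q + 1) v) b i =
      if b = a ∧ i = q + 1 then v else t b i := by
    intro b i
    by_cases hb : b = a
    · subst hb
      by_cases hi : i = q + 1 <;> simp [hi]
    · simp [hb]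
  constructor
  · intro b i
    rw [hval]
    split_ifs
    exacts [hmv, ht.le_apply b i]
  · intro b i
    rw [hval]
    split_ifs
    exacts [hvn, ht.apply_le b i]
  · intro b i
    have := ht.anti b i
    rw [hval, hval]
    split_ifs with e₁ e₂ e₂
    · rfl
    · obtain ⟨rfl, e⟩ := e₁
      obtain rfl : i = q := by omega
      exact h₂
    · obtain ⟨rfl, rfl⟩ := e₂
      exact h₁
    · exact this
  · intro b i
    have := ht.diag b i
    rw [hval, hval]
    split_ifs with e₁ e₂ e₂
    · rfl
    · obtain ⟨rfl, rfl⟩ := e₁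
      exact h₃
    · obtain ⟨e, e'⟩ := e₂
      obtain rfl : i = q := by omega
      exact h₄ b e
    · exact this
  · intro b i hb
    rw [hval, if_neg (by omega)]
    exact ht.eq_of_le b i hb

/-- The indicator of `p ≤ s`. -/
def step (p s : ℕ) : ℤ := if p ≤ s then 1 else 0

theorem step_mono (p : ℕ) {s s' : ℕ} (h : s ≤ s') : step p s ≤ step p s' := by
  unfold step; split_ifs <;> omega

theorem step_nonneg (p s : ℕ) : 0 ≤ step p s := by unfold step; split_ifs <;> omega

theorem step_le_one (p s : ℕ) : step p s ≤ 1 := by unfold step; split_ifs <;> omega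

/-- `N'` arises from `N` on the window `[m, n]` by moving a jump at time `p` from row `q + 1` to
row `q`. -/
structure IsMove (r m n q p : ℕ) (N N' : ℕ → ℕ → ℤ) : Prop where
  lt : q + 1 < r
  mem : m < p ∧ p ≤ n
  apply_left : ∀ s, N' q s = N q s + step p s
  apply_right : ∀ s, N' (q + 1) s = N (q + 1) s - step p s
  apply_of_ne : ∀ i s, i ≠ q → i ≠ q + 1 → N' i s = N i s

namespace IsMove

variable {r k m n q p : ℕ} {N N' : ℕ → ℕ → ℤ}

theorem pathWeight_eq (h : IsMove r m n q p N N') (x : ℕ → ℕ) :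
    pathWeight r N' x = pathWeight r N x + (step p (x q) - step p (x (q + 1))) -
      (step p (x (q + 1)) - step p (x (q + 1 + 1))) := by
  have hq := h.lt
  rw [add_sub_assoc, ← sub_eq_iff_eq_add', pathWeight, pathWeight, ← Finset.sum_sub_distrib,
    Finset.sum_eq_add_of_mem q (q + 1) (by simp; omega) (by simpa using hq) (by omega)]
  · rw [h.apply_left, h.apply_left, h.apply_right, h.apply_right]
    ring
  · rintro i - ⟨h₁, h₂⟩
    rw [h.apply_of_ne i _ h₁ h₂, h.apply_of_ne i _ h₁ h₂]
    ring

theorem sum_pathWeight_eq (h : IsMove r m n q p N N') (k : ℕ) (t : ℕ → ℕ → ℕ) :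
    ∑ a ∈ Finset.range k, pathWeight r N' (t a) = ∑ a ∈ Finset.range k, pathWeight r N (t a) +
      ∑ a ∈ Finset.range k, (step p (t a q) - step p (t a (q + 1))) -
      ∑ a ∈ Finset.range k, (step p (t a (q + 1)) - step p (t a (q + 1 + 1))) := by
  rw [← Finset.sum_add_distrib, ← Finset.sum_sub_distrib]
  exact Finset.sum_congr rfl fun a _ => h.pathWeight_eq (t a)

end IsMove

theorem IsInterlacing.sum_step_le_one {k m n : ℕ} {t : ℕ → ℕ → ℕ} (ht : IsInterlacing k m n t)
    (p i k' : ℕ) :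
    ∑ a ∈ Finset.range k', (step p (t a i) - step p (t a (i + 1))) ≤ 1 := by
  have : ∑ a ∈ Finset.range k', (step p (t a i) - step p (t a (i + 1))) ≤
      step p (t k' (i + 1)) - step p (t 0 (i + 1)) := by
    rw [← Finset.sum_range_sub (fun a => step p (t a (i + 1)))]
    exact Finset.sum_le_sum fun a _ => by
      have := step_mono p (ht.diag a i)
      omega
  have h₁ := step_le_one p (t k' (i + 1))
  have h₂ := step_nonneg p (t 0 (i + 1))
  omega

theorem IsInterlacing.sum_step_cases {k m n : ℕ} {t : ℕ → ℕ → ℕ} (ht : IsInterlacing k m n t)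
    (p i : ℕ) :
    (∑ a ∈ Finset.range k, (step p (t a i) - step p (t a (i + 1))) = 0 ∧
      ∀ a < k, p ≤ t a i → p ≤ t a (i + 1)) ∨
    (∑ a ∈ Finset.range k, (step p (t a i) - step p (t a (i + 1))) = 1 ∧
      ∃ a < k, t a (i + 1) < p ∧ p ≤ t a i) := by
  have hnn : ∀ a ∈ Finset.range k, 0 ≤ step p (t a i) - step p (t a (i + 1)) := fun a _ =>
    sub_nonneg.2 (step_mono p (ht.anti a i))
  by_cases hex : ∃ a < k, t a (i + 1) < p ∧ p ≤ t a i
  · right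
    refine ⟨le_antisymm (ht.sum_step_le_one p i k) ?_, hex⟩
    obtain ⟨a, ha, h₁, h₂⟩ := hex
    refine le_trans ?_ (Finset.single_le_sum hnn (Finset.mem_range.2 ha))
    simp only [step]
    rw [if_pos h₂, if_neg (by omega)]
    omega
  · left
    push Not at hex
    have hall : ∀ a < k, p ≤ t a i → p ≤ t a (i + 1) := fun a ha h₁ => by
      by_contra h₂
      have := hex a ha (by omega)
      omega
    refine ⟨Finset.sum_eq_zero fun a ha => ?_, hall⟩
    have h₁ := hall a (Finset.mem_range.1 ha)
    have h₂ := ht.anti a i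
    simp only [step]
    split_ifs <;> omega

namespace IsMove

variable {r k m n q p : ℕ} {N N' : ℕ → ℕ → ℤ}

theorem dominated (h : IsMove r m n q p N N') (k : ℕ)
    (hp : N q (p - 1) = N (q + 1) (p - 1))
    (hD : ∀ s, p ≤ s → s ≤ n → N (q + 1) s ≤ N q s + 1) : Dominated r k m n N N' := by
  intro t ht
  have hmem := h.mem
  have hsum := h.sum_pathWeight_eq k t
  rcases ht.sum_step_cases p q with ⟨h₀, hgain⟩ | ⟨h₀, -⟩
  · rcases ht.sum_step_cases p (q + 1) with ⟨h₁, -⟩ | ⟨h₁, a, ha, hz, hy⟩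
    · exact ⟨t, ht, by omega⟩
    · have hx := ht.anti a q
      refine ⟨_, ht.update (q := q) (v := p - 1) ha (by omega) (by omega) (by omega) (by omega) ?_ ?_, ?_⟩
      · have := ht.diag a (q + 1)
        omega
      · rintro b rfl
        have h₂ := hgain b (by omega)
        have h₃ := ht.diag b (q + 1)
        by_contra h₄
        have := h₂ (by omega)
        omega
      · rw [sum_pathWeight_update h.lt ha, h.apply_left, h.apply_left, h.apply_right,
          h.apply_right, hp]
        have h₂ := hD _ hy (ht.apply_le a (q + 1))
        simp only [step] at *
        rw [if_pos hy, if_neg (by omega)]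
        omega
  · rcases ht.sum_step_cases p (q + 1) with ⟨h₁, -⟩ | ⟨h₁, -⟩ <;> exact ⟨t, ht, by omega⟩

theorem dominated_symm (h : IsMove r m n q p N N') (k : ℕ)
    (hp : N (q + 1) p = N q p + 1)
    (hD : ∀ s, m ≤ s → s < p → N (q + 1) s ≤ N q s) : Dominated r k m n N' N := by
  intro t ht
  have hmem := h.mem
  have hsum := h.sum_pathWeight_eq k t
  rcases ht.sum_step_cases p (q + 1) with ⟨h₁, hloss⟩ | ⟨h₁, -⟩
  · rcases ht.sum_step_cases p q with ⟨h₀, -⟩ | ⟨h₀, a, ha, hy, hx⟩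
    · exact ⟨t, ht, by omega⟩
    · have hz := ht.anti a (q + 1)
      refine ⟨_, ht.update (q := q) (v := p) ha (by omega) (by omega) (by omega) hx ?_ ?_, ?_⟩
      · by_cases hak : a + 1 < k
        · have := ht.diag a q
          exact hloss _ hak (by omega)
        · rw [ht.eq_of_le _ _ (by omega)]
          omega
      · rintro b rfl
        have := ht.diag b q
        omega
      · rw [sum_pathWeight_update h.lt ha, hp]
        have h₂ := hD _ (ht.le_apply a (q + 1)) hy
        omega
  · rcases ht.sum_step_cases p q with ⟨h₀, -⟩ | ⟨h₀, -⟩ <;> exact ⟨t, ht, by omega⟩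

end IsMove

/-! ### Extremal values of the functional -/

theorem isInterlacing_corner {k m n : ℕ} (hmn : m ≤ n) (d : ℕ) :
    IsInterlacing k m n fun a i => if i ≤ d + a ∨ k ≤ a then n else m := by
  constructor
  · intro a i
    split_ifs <;> omega
  · intro a i
    split_ifs <;> omega
  · intro a i
    split_ifs <;> omega
  · intro a i
    split_ifs <;> omega
  · intro a i ha
    simp [ha]

theorem sum_pathWeight_corner {r k m n d : ℕ} (hd : d + k ≤ r) (N : ℕ → ℕ → ℤ) :
    ∑ a ∈ Finset.range k, pathWeight r N (fun i => if i ≤ d + a ∨ k ≤ a then n else m) =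
      ∑ a ∈ Finset.range k, (N (d + a) n - N (d + a) m) := by
  refine Finset.sum_congr rfl fun a ha => ?_
  have ha := Finset.mem_range.1 ha
  rw [pathWeight, Finset.sum_eq_single_of_mem (d + a) (by simp; omega)]
  · rw [if_pos (by omega), if_neg (by omega)]
  · intro i _ hi
    split_ifs <;> omega

theorem sum_pathWeight_le_of_highest {r k m n : ℕ} {N : ℕ → ℕ → ℤ} (hN : ∀ i, Monotone (N i))
    (hN₀ : ∀ i s, 0 ≤ N i s) (hdom : ∀ i s, i + 1 < r → N (i + 1) s ≤ N i s)
    {t : ℕ → ℕ → ℕ} (ht : IsInterlacing k m n t) (j : ℕ) (hj : j ≤ r) :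
    ∑ a ∈ Finset.range j, pathWeight r N (t a) ≤ ∑ i ∈ Finset.range j, N i (t j (i + 1)) := by
  induction j with
  | zero => simp
  | succ j ih =>
    have htel : ∀ r', j < r' → r' ≤ r →
        ∑ i ∈ Finset.Ico j r', (N i (t j i) - N i (t j (i + 1))) ≤
          N j (t j j) - N (r' - 1) (t j r') := by
      intro r' hr'
      induction r', hr' using Nat.le_induction with
      | base => simp
      | succ r' hr' ih' =>
        intro hle
        rw [Finset.sum_Ico_succ_top (by omega)]
        have h₁ := ih' (by omega)
        have h₂ := hdom (r' - 1) (t j r') (by omega)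
        rw [Nat.sub_add_cancel (by omega)] at h₂
        simp only [add_tsub_cancel_right]
        omega
    have h₁ := htel r (by omega) le_rfl
    have h₂ := hN₀ (r - 1) (t j r)
    have h₃ := ih (by omega)
    have h₄ : ∑ i ∈ Finset.range (j + 1), N i (t j i) ≤
        ∑ i ∈ Finset.range (j + 1), N i (t (j + 1) (i + 1)) :=
      Finset.sum_le_sum fun i _ => hN i (ht.diag j i)
    rw [Finset.sum_range_succ] at h₄
    have h₅ := Finset.sum_range_add_sum_Ico (fun i => N i (t j i) - N i (t j (i + 1)))
      (show j ≤ r by omega)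
    rw [Finset.sum_sub_distrib] at h₅
    rw [Finset.sum_range_succ]
    simp only [pathWeight] at h₃ ⊢
    omega

theorem sum_pathWeight_le_of_lowest {r : ℕ} {c : ℤ} {N : ℕ → ℕ → ℤ} (hN : ∀ i, Monotone (N i))
    (hNc : ∀ i s, N i s ≤ c) (hdom : ∀ i s, i + 1 < r → N (i + 1) s ≤ N i s)
    (j : ℕ) (hj : j ≤ r) (t : ℕ → ℕ → ℕ) (ht : ∀ a i, t a i ≤ t (a + 1) (i + 1)) (u : ℕ → ℕ)
    (hu : ∀ i, u i ≤ t 0 (i + 1)) :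
    ∑ a ∈ Finset.range j, pathWeight r N (t a) ≤ ∑ i ∈ Finset.Ico (r - j) r, (c - N i (u i)) := by
  induction j generalizing t u with
  | zero => simp
  | succ j ih =>
    have htel : ∀ r', r' < r → ∑ i ∈ Finset.range (r' + 1), (N i (t 0 i) - N i (t 0 (i + 1))) ≤
        c - N r' (t 0 (r' + 1)) := by
      intro r'
      induction r' with
      | zero =>
        intro _
        have := hNc 0 (t 0 0)
        rw [Finset.sum_range_one]
        omega
      | succ r' ih' =>
        intro hr'
        have h₁ := ih' (by omega)
        have h₂ := hdom r' (t 0 (r' + 1)) hr'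
        rw [Finset.sum_range_succ]
        omega
    have h₁ := htel (r - (j + 1)) (by omega)
    rw [show r - (j + 1) + 1 = r - j by omega] at h₁
    have h₂ := ih (by omega) (fun a => t (a + 1)) (fun a i => ht (a + 1) i) (t 0) (ht 0)
    have h₃ : ∑ i ∈ Finset.Ico (r - (j + 1)) r, (c - N i (t 0 (i + 1))) ≤
        ∑ i ∈ Finset.Ico (r - (j + 1)) r, (c - N i (u i)) :=
      Finset.sum_le_sum fun i _ => sub_le_sub_left (hN i (hu i)) c
    rw [Finset.sum_eq_sum_Ico_succ_bot (by omega), show r - (j + 1) + 1 = r - j by omega] at h₃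
    have h₄ := Finset.sum_range_add_sum_Ico (fun i => N i (t 0 i) - N i (t 0 (i + 1)))
      (show r - j ≤ r by omega)
    have h₅ : ∑ i ∈ Finset.Ico (r - j) r, (N i (t 0 i) - N i (t 0 (i + 1))) =
        ∑ i ∈ Finset.Ico (r - j) r, (c - N i (t 0 (i + 1))) -
          ∑ i ∈ Finset.Ico (r - j) r, (c - N i (t 0 i)) := by
      rw [← Finset.sum_sub_distrib]
      exact Finset.sum_congr rfl fun i _ => by ring
    rw [Finset.sum_range_succ']
    simp only [pathWeight] at h₂ ⊢
    omega

/-- The functional compares a family of counting functions that exhausts every row by time `n`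
with one that is empty at time `m`. -/
theorem sum_eq_of_dominated {r k m n : ℕ} {c : ℤ} {N N' : ℕ → ℕ → ℤ} (hk : k ≤ r) (hmn : m ≤ n)
    (hN : ∀ i, Monotone (N i)) (hNc : ∀ i s, N i s ≤ c)
    (hdom : ∀ i s, i + 1 < r → N (i + 1) s ≤ N i s) (hn : ∀ i < r, N i n = c)
    (hN' : ∀ i, Monotone (N' i)) (hN₀' : ∀ i s, 0 ≤ N' i s)
    (hdom' : ∀ i s, i + 1 < r → N' (i + 1) s ≤ N' i s) (hm : ∀ i < r, N' i m = 0)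
    (h : Dominated r k m n N N') (h' : Dominated r k m n N' N) :
    ∑ i ∈ Finset.range k, N' i n = ∑ i ∈ Finset.Ico (r - k) r, (c - N i m) := by
  apply le_antisymm
  · obtain ⟨t, ht, hle⟩ := h' _ (isInterlacing_corner hmn 0)
    rw [sum_pathWeight_corner (by omega)] at hle
    refine le_trans (Finset.sum_le_sum fun i hi => ?_) (hle.trans
      (sum_pathWeight_le_of_lowest hN hNc hdom k hk t ht.diag (fun _ => m)
        fun i => ht.le_apply 0 (i + 1)))
    rw [zero_add, hm i (by simp at hi; omega), sub_zero]
  · obtain ⟨t, ht, hle⟩ := h _ (isInterlacing_corner hmn (r - k))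
    rw [sum_pathWeight_corner (by omega)] at hle
    rw [Finset.sum_Ico_eq_sum_range, show r - (r - k) = k by omega]
    refine le_trans (Finset.sum_le_sum fun i hi => ?_) (hle.trans
      ((sum_pathWeight_le_of_highest hN' hN₀' hdom' ht k hk).trans
        (Finset.sum_le_sum fun i _ => hN' i (ht.apply_le k (i + 1)))))
    rw [hn _ (by simp at hi; omega)]

/-! ## Row counting functions under gromotion -/

/-- The number of entries at most `s` in row `i` of `T`. -/
def rowCount (c : ℕ) (T : ℕ → ℕ → ℕ) (i s : ℕ) : ℤ := ∑ j ∈ Finset.range c, step (T i j) s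

theorem rowCount_mono (c : ℕ) (T : ℕ → ℕ → ℕ) (i : ℕ) : Monotone (rowCount c T i) := fun _ _ h =>
  Finset.sum_le_sum fun _ _ => step_mono _ h

theorem rowCount_nonneg (c : ℕ) (T : ℕ → ℕ → ℕ) (i s : ℕ) : 0 ≤ rowCount c T i s :=
  Finset.sum_nonneg fun _ _ => step_nonneg _ _

theorem rowCount_le (c : ℕ) (T : ℕ → ℕ → ℕ) (i s : ℕ) : rowCount c T i s ≤ c :=
  (Finset.sum_le_card_nsmul _ _ 1 fun _ _ => step_le_one _ _).trans (by simp)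

theorem rowCount_eq {c k : ℕ} {T : ℕ → ℕ → ℕ} {i s : ℕ} (hk : k ≤ c)
    (h : ∀ j < c, T i j ≤ s ↔ j < k) : rowCount c T i s = k := by
  rw [rowCount, ← Finset.sum_range_add_sum_Ico _ hk,
    Finset.sum_congr (g := fun _ => (1 : ℤ)) rfl, Finset.sum_eq_zero (s := Finset.Ico k c)]
  · simp
  · intro j hj
    rw [Finset.mem_Ico] at hj
    rw [step, if_neg]
    rw [h j hj.2]
    omega
  · intro j hj
    rw [Finset.mem_range] at hj
    rw [step, if_pos]
    rw [h j (by omega)]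
    exact hj

theorem sum_range_eq_of_shift {f f' : ℕ → ℤ} {a b c : ℕ} (hab : a ≤ b) (hbc : b < c)
    (h : ∀ j < c, j < a ∨ b < j → f' j = f j) (hs : ∀ j, a ≤ j → j < b → f' j = f (j + 1)) :
    ∑ j ∈ Finset.range c, f' j = ∑ j ∈ Finset.range c, f j - f a + f' b := by
  have split := fun g : ℕ → ℤ => by
    have h₁ := Finset.sum_range_add_sum_Ico g (show a ≤ c by omega)
    have h₂ := Finset.sum_Ico_consecutive g hab hbc.le
    have h₃ := Finset.sum_eq_sum_Ico_succ_bot hbc g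
    exact (show ∑ j ∈ Finset.range c, g j = ∑ j ∈ Finset.range a, g j +
      ∑ j ∈ Finset.Ico a b, g j + g b + ∑ j ∈ Finset.Ico (b + 1) c, g j by omega)
  rw [split f', split f,
    Finset.sum_congr (s₁ := Finset.range a) rfl fun j hj => h j
      (by simp at hj; omega) (by simp at hj; omega),
    Finset.sum_congr (s₁ := Finset.Ico (b + 1) c) rfl fun j hj => h j
      (by simp at hj; omega) (by simp at hj; omega),
    Finset.sum_congr (s₁ := Finset.Ico a b) rfl fun j hj => hs j
      (by simp at hj; omega) (by simp at hj; omega)]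
  have := Finset.sum_Ico_sub f hab
  rw [Finset.sum_sub_distrib] at this
  linarith

theorem rowCount_gromotion {R c : ℕ} {T : ℕ → ℕ → ℕ} (hc : 0 < c) {i : ℕ} (hi : i + 1 < R)
    (s : ℕ) : rowCount c (gromotion R c T) i s =
      rowCount c T i s - step (T i (enterCol R c T i)) s +
        step (T (i + 1) (enterCol R c T (i + 1))) s := by
  have := sum_range_eq_of_shift (f := fun j => step (T i j) s)
    (f' := fun j => step (gromotion R c T i j) s) (enterCol_le_succ (R := R) (T := T) i)
    (enterCol_lt hc (i + 1)) (fun j hj h => by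
      rw [gromotion_of_not_mem (by omega) (by omega)])
    (fun j h₁ h₂ => by rw [gromotion_of_lt (by omega) hc h₁ h₂])
  rwa [gromotion_enterCol hi hc] at this

namespace IsShiftedSYT

variable {R r c l m n : ℕ} {T Q : ℕ → ℕ → ℕ}

theorem rowCount_succ_le (hT : IsShiftedSYT R c l T) {i : ℕ} (hi : i + 1 < R) (s : ℕ) :
    rowCount c T (i + 1) s ≤ rowCount c T i s := by
  refine Finset.sum_le_sum fun j hj => ?_
  have := hT.col_succ i j hi (Finset.mem_range.1 hj)
  unfold step
  split_ifs <;> omega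

/-- The row counts of a gromotion that has been carried out only down to row `q`. -/
noncomputable def partialCount (R c : ℕ) (T : ℕ → ℕ → ℕ) (q i s : ℕ) : ℤ :=
  rowCount c T i s - (if i ≤ q then step (T i (enterCol R c T i)) s else 0) +
    (if i < q then step (T (i + 1) (enterCol R c T (i + 1))) s else 0)

theorem isMove_partialCount {q : ℕ} (hq : q + 1 < r)
    (hm : m < T (q + 1) (enterCol R c T (q + 1))) (hn : T (q + 1) (enterCol R c T (q + 1)) ≤ n) :
    IsMove r m n q (T (q + 1) (enterCol R c T (q + 1))) (partialCount R c T q)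
      (partialCount R c T (q + 1)) where
  lt := hq
  mem := ⟨hm, hn⟩
  apply_left s := by
    simp only [partialCount]
    rw [if_pos (by omega), if_pos (by omega), if_pos le_rfl, if_neg (by omega)]
    ring
  apply_right s := by
    simp only [partialCount]
    rw [if_pos le_rfl, if_neg (by omega), if_neg (by omega), if_neg (by omega)]
    ring
  apply_of_ne i s h₁ h₂ := by
    simp only [partialCount]
    congr 2
    · simp only [show i ≤ q + 1 ↔ i ≤ q by omega]
    · simp only [show i < q + 1 ↔ i < q by omega]

theorem dominated_partialCount (hT : IsShiftedSYT R c l T) (hc : 0 < c) {q : ℕ} (hq : q + 1 < r)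
    (hr : r < R) (k m n : ℕ) :
    Dominated r k m n (partialCount R c T q) (partialCount R c T (q + 1)) ∧
    Dominated r k m n (partialCount R c T (q + 1)) (partialCount R c T q) := by
  have hconst : ∀ v : ℤ, (∀ s, m ≤ s → s ≤ n →
      step (T (q + 1) (enterCol R c T (q + 1))) s = v) → ∀ i s, m ≤ s → s ≤ n →
      partialCount R c T (q + 1) i s = partialCount R c T q i s +
        ((if i = q then v else 0) - if i = q + 1 then v else 0) := by
    intro v hv i s h₁ h₂
    rcases eq_or_ne i q with rfl | hi
    · simp [partialCount, hv s h₁ h₂]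
    · rcases eq_or_ne i (q + 1) with rfl | hi'
      · simp [partialCount, hv s h₁ h₂, sub_eq_add_neg]
      · simp only [partialCount, show i ≤ q + 1 ↔ i ≤ q by omega,
          show i < q + 1 ↔ i < q by omega, if_neg hi, if_neg hi']
        ring
  have dom_of_const : ∀ v : ℤ, (∀ s, m ≤ s → s ≤ n →
      step (T (q + 1) (enterCol R c T (q + 1))) s = v) →
      Dominated r k m n (partialCount R c T q) (partialCount R c T (q + 1)) ∧
      Dominated r k m n (partialCount R c T (q + 1)) (partialCount R c T q) := fun v hv =>
    ⟨dominated_of_add_const _ fun i _ s h₁ h₂ => hconst v hv i s h₁ h₂,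
      dominated_of_add_const (fun i => -((if i = q then v else 0) - if i = q + 1 then v else 0))
        fun i _ s h₁ h₂ => by rw [hconst v hv i s h₁ h₂]; ring⟩
  by_cases hm : T (q + 1) (enterCol R c T (q + 1)) ≤ m
  · exact dom_of_const 1 fun s h₁ _ => if_pos (by omega)
  by_cases hn : n < T (q + 1) (enterCol R c T (q + 1))
  · exact dom_of_const 0 fun s _ h₂ => if_neg (by omega)
  have hmove := isMove_partialCount (n := n) hq (not_le.1 hm) (not_lt.1 hn)
  have hb := enterCol_lt (R := R) (T := T) hc (q + 1)
  have hpq := hT.apply_enterCol_lt hc (i := q) (by omega)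
  have hpq' := hT.apply_enterCol_lt hc (i := q + 1) (by omega)
  have hT' := hT.gromotion (by omega) hc
  have hlow : ∀ s, s < T (q + 1) (enterCol R c T (q + 1)) →
      rowCount c T (q + 1) s ≤ rowCount c T q s - step (T q (enterCol R c T q)) s := by
    intro s hs
    have h₁ := hT'.rowCount_succ_le (i := q) (by omega) s
    rw [rowCount_gromotion hc (by omega), rowCount_gromotion hc (by omega)] at h₁
    simp only [step] at h₁ ⊢
    rw [if_neg (show ¬ T (q + 1) (enterCol R c T (q + 1)) ≤ s by omega),
      if_neg (show ¬ T (q + 1 + 1) (enterCol R c T (q + 1 + 1)) ≤ s by omega)] at h₁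
    omega
  have hleft : ∀ s, T (q + 1) (enterCol R c T (q + 1)) ≤ s + 1 →
      s ≤ T (q + 1) (enterCol R c T (q + 1)) →
      rowCount c T q s = (enterCol R c T (q + 1) + 1 : ℕ) := by
    intro s hs hs'
    refine rowCount_eq (by omega) fun j hj => ⟨fun h => ?_, fun h => ?_⟩
    · by_contra hlt
      have := hT.row_le (i := q) (j := enterCol R c T (q + 1) + 1) (by omega) (by omega) hj
      have := hT.enterCol_lt_apply (i := q) (by omega) (by omega)
      omega
    · have := hT.row_le (i := q) (j := j) (j' := enterCol R c T (q + 1)) (by omega) (by omega) hb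
      have := hT.col_succ q (enterCol R c T (q + 1)) (by omega) hb
      omega
  have hself : rowCount c T (q + 1) (T (q + 1) (enterCol R c T (q + 1))) =
      (enterCol R c T (q + 1) + 1 : ℕ) := by
    refine rowCount_eq (by omega) fun j hj => ⟨fun h => ?_, fun h => ?_⟩
    · by_contra hlt
      have := hT.row_lt (i := q + 1) (j := enterCol R c T (q + 1)) (by omega) (by omega) hj
      omega
    · exact hT.row_le (by omega) (by omega) hb
  have hpred : rowCount c T (q + 1) (T (q + 1) (enterCol R c T (q + 1)) - 1) =
      (enterCol R c T (q + 1) : ℕ) := by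
    refine rowCount_eq (by omega) fun j hj => ⟨fun h => ?_, fun h => ?_⟩
    · by_contra hlt
      have := hT.row_le (i := q + 1) (j := enterCol R c T (q + 1)) (by omega) (by omega) hj
      omega
    · have := hT.row_lt (i := q + 1) (j := j) (by omega) h hb
      omega
  have e₁ : ∀ s, partialCount R c T q q s =
      rowCount c T q s - step (T q (enterCol R c T q)) s := by simp [partialCount]
  have e₂ : ∀ s, partialCount R c T q (q + 1) s = rowCount c T (q + 1) s := by
    simp [partialCount]
  refine ⟨hmove.dominated k ?_ ?_, hmove.dominated_symm k ?_ ?_⟩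
  · rw [e₁, e₂, hpred, hleft _ (by omega) (by omega), step, if_pos (by omega)]
    push_cast
    ring
  · intro s h₁ _
    rw [e₁, e₂]
    have := hT.rowCount_succ_le (i := q) (by omega) s
    have := step_le_one (T q (enterCol R c T q)) s
    omega
  · rw [e₁, e₂, hself, hleft _ (by omega) le_rfl, step, if_pos (by omega)]
    push_cast
    ring
  · intro s _ h₁
    rw [e₁, e₂]
    exact hlow s h₁

theorem dominated_gromotion (hT : IsShiftedSYT R c l T) (hc : 0 < c) (hr : 0 < r) (hrR : r < R)
    (hl : l < m) (hn : n < T r (enterCol R c T r)) (k : ℕ) :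
    Dominated r k m n (rowCount c T) (rowCount c (PromRS.gromotion R c T)) ∧
    Dominated r k m n (rowCount c (PromRS.gromotion R c T)) (rowCount c T) := by
  have hstart : ∀ i s, m ≤ s → partialCount R c T 0 i s =
      rowCount c T i s + if i = 0 then -1 else 0 := by
    intro i s hs
    rcases Nat.eq_zero_or_pos i with rfl | hi
    · have : T 0 (enterCol R c T 0) = l + 1 := hT.apply_zero_zero (by omega) hc
      simp only [partialCount, this, step, le_refl, if_true, lt_irrefl, if_false]
      rw [if_pos (by omega)]
      ring
    · simp [partialCount, hi.ne']
  have hend : ∀ i < r, ∀ s, s ≤ n → rowCount c (PromRS.gromotion R c T) i s =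
      partialCount R c T (r - 1) i s := by
    intro i hi s hs
    rw [rowCount_gromotion hc (by omega), partialCount, if_pos (by omega)]
    congr 1
    split_ifs with h
    · rfl
    · obtain rfl : r = i + 1 := by omega
      exact if_neg (by omega)
  have hmid : ∀ q < r, Dominated r k m n (partialCount R c T 0) (partialCount R c T q) ∧
      Dominated r k m n (partialCount R c T q) (partialCount R c T 0) := by
    intro q hq
    induction q with
    | zero => exact ⟨fun t ht => ⟨t, ht, le_rfl⟩, fun t ht => ⟨t, ht, le_rfl⟩⟩
    | succ q ih =>
      have h := hT.dominated_partialCount hc hq hrR k m n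
      exact ⟨(ih (by omega)).1.trans h.1, h.2.trans (ih (by omega)).2⟩
  have h := hmid (r - 1) (by omega)
  constructor
  · exact ((dominated_of_add_const (fun i => if i = 0 then -1 else 0)
      fun i _ s h₁ _ => hstart i s h₁).trans h.1).trans
        (dominated_of_add_const 0 fun i hi s _ h₂ => by rw [hend i hi s h₂]; simp)
  · exact ((dominated_of_add_const 0 fun i hi s _ h₂ => by rw [hend i hi s h₂]; simp).trans
      h.2).trans (dominated_of_add_const (fun i => -(if i = 0 then -1 else 0))
        fun i _ s h₁ _ => by rw [hstart i s h₁]; ring)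

end IsShiftedSYT

/-! ## Gromotion of a stacked tableau -/

section Stack

variable {r c : ℕ} {P Q : ℕ → ℕ → ℕ}

theorem isShiftedSYT_iterate_stack (hP : IsSYT r c P) (hQ : IsSYT r c Q) (hr : 0 < r)
    (hc : 0 < c) (l : ℕ) :
    IsShiftedSYT (2 * r) c l ((gromotion (2 * r) c)^[l] (stack r c P Q)) := by
  simpa using (isShiftedSYT_stack hP hQ).iterate_gromotion (by omega) hc l

theorem exists_hasRaisedColumns (hP : IsSYT r c P) (hQ : IsSYT r c Q) (hr : 0 < r) (hc : 0 < c)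
    {l : ℕ} (hl : l ≤ r * c) :
    ∃ h, HasRaisedColumns r c Q h ((gromotion (2 * r) c)^[l] (stack r c P Q)) := by
  induction l with
  | zero => exact ⟨_, hasRaisedColumns_stack hP⟩
  | succ l ih =>
    obtain ⟨h, H⟩ := ih (by omega)
    have hT := isShiftedSYT_iterate_stack hP hQ hr hc l
    obtain ⟨e, k, he, hk, hhk, -, hk1, hTk, hek, hb⟩ := H.exists_slide hQ hT (by omega)
    rw [Function.iterate_succ_apply']
    exact ⟨_, H.gromotion hQ hT he hk hhk hk1 hTk hek hb⟩

theorem dominated_iterate_stack (hP : IsSYT r c P) (hQ : IsSYT r c Q) (hr : 0 < r) (hc : 0 < c)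
    {l m : ℕ} (hlm : l ≤ m) (hm : m ≤ r * c) (k : ℕ) :
    Dominated r k m (r * c) (rowCount c (stack r c P Q))
      (rowCount c ((gromotion (2 * r) c)^[l] (stack r c P Q))) ∧
    Dominated r k m (r * c) (rowCount c ((gromotion (2 * r) c)^[l] (stack r c P Q)))
      (rowCount c (stack r c P Q)) := by
  induction l with
  | zero => exact ⟨fun t ht => ⟨t, ht, le_rfl⟩, fun t ht => ⟨t, ht, le_rfl⟩⟩
  | succ l ih =>
    obtain ⟨h, H⟩ := exists_hasRaisedColumns hP hQ hr hc (show l ≤ r * c by omega)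
    have hb := enterCol_lt (R := 2 * r) (T := (gromotion (2 * r) c)^[l] (stack r c P Q)) hc r
    have := (isShiftedSYT_iterate_stack hP hQ hr hc l).dominated_gromotion (m := m) hc hr
      (by omega) (by omega) (H.lt_of_le hQ (by omega) hb (H.height_le _ hb)) k
    rw [Function.iterate_succ_apply']
    exact ⟨(ih (by omega)).1.trans this.1, this.2.trans (ih (by omega)).2⟩

/-- The entries of the upper half that survive `m` gromotions form the complement of the rotated
shape of the entries of `P` that are at most `m`. -/
theorem rowCount_iterate_stack (hP : IsSYT r c P) (hQ : IsSYT r c Q) (hr : 0 < r) (hc : 0 < c)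
    {m i : ℕ} (hm : m ≤ r * c) (hi : i < r) :
    rowCount c ((gromotion (2 * r) c)^[m] (stack r c P Q)) i (r * c) =
      c - rowCount c P (r - 1 - i) m := by
  have hS := isShiftedSYT_stack hP hQ
  have hT := isShiftedSYT_iterate_stack hP hQ hr hc m
  have key : ∀ k ≤ r, ∑ i ∈ Finset.range k,
      rowCount c ((gromotion (2 * r) c)^[m] (stack r c P Q)) i (r * c) =
        ∑ i ∈ Finset.Ico (r - k) r, (c - rowCount c (stack r c P Q) i m) := by
    intro k hk
    have hd := dominated_iterate_stack hP hQ hr hc le_rfl hm k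
    refine sum_eq_of_dominated hk hm (rowCount_mono c _) (rowCount_le c _)
      (fun i s hi => hS.rowCount_succ_le (by omega) s) (fun i hi => ?_) (rowCount_mono c _)
      (rowCount_nonneg c _) (fun i s hi => hT.rowCount_succ_le (by omega) s) (fun i hi => ?_)
      hd.1 hd.2
    · refine rowCount_eq le_rfl fun j hj => iff_of_true ?_ hj
      simpa [stack, hi] using (hP.isShiftedSYT.mem_Icc hi hj).2
    · refine (rowCount_eq (Nat.zero_le c) fun j hj => iff_of_false ?_ (by omega)).trans (by simp)
      have := (hT.mem_Icc (i := i) (by omega) hj).1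
      omega
  have h₁ := key i hi.le
  have h₂ := key (i + 1) hi
  have h₃ : rowCount c (stack r c P Q) (r - 1 - i) m = rowCount c P (r - 1 - i) m := by
    simp [rowCount, stack, show r - 1 - i < r by omega]
  rw [Finset.sum_range_succ, h₁, Finset.sum_eq_sum_Ico_succ_bot (show r - (i + 1) < r by omega),
    show r - (i + 1) + 1 = r - i by omega, show r - (i + 1) = r - 1 - i by omega, h₃] at h₂
  omega

theorem slideInto_iterate_stack (hP : IsSYT r c P) (hQ : IsSYT r c Q) {m i j : ℕ} (hi : i < r)
    (hj : j < c) (hm : P i j = m + 1) :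
    slideInto (2 * r) c ((gromotion (2 * r) c)^[m] (stack r c P Q)) r =
      r * c + Q i (c - 1 - j) := by
  have hr : 0 < r := by omega
  have hc : 0 < c := by omega
  have hP' := hP.isShiftedSYT
  have hmn : m + 1 ≤ r * c := by
    have := (hP'.mem_Icc hi hj).2
    omega
  obtain ⟨h, H⟩ := exists_hasRaisedColumns hP hQ hr hc (show m ≤ r * c by omega)
  have hT := isShiftedSYT_iterate_stack hP hQ hr hc m
  obtain ⟨e, k, he, hk, hhk, hpe, hk1, hTk, hek, hb⟩ := H.exists_slide hQ hT (by omega)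
  have c₁ := rowCount_iterate_stack hP hQ hr hc (show m ≤ r * c by omega) he
  have c₂ := rowCount_iterate_stack hP hQ hr hc hmn he
  rw [Function.iterate_succ_apply'] at c₂
  rw [slideInto_eq hc (by omega), hb r he (by omega)]
  generalize (gromotion (2 * r) c)^[m] (stack r c P Q) = T at *
  have hie : i = r - 1 - e := by
    by_contra hne
    have hsame : rowCount c P (r - 1 - e) (m + 1) = rowCount c P (r - 1 - e) m := by
      refine Finset.sum_congr rfl fun j' hj' => ?_
      have : P (r - 1 - e) j' ≠ m + 1 := fun h' =>
        hne (hP'.inj hi hj (by omega) (Finset.mem_range.1 hj') (hm.trans h'.symm)).1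
      unfold step
      split_ifs <;> omega
    have hlt := H.lt_of_le hQ (i := e + 1) (by omega) hk hhk.le
    rw [rowCount_gromotion hc (by omega), hb (e + 1) (by omega) (by omega), step, step,
      if_pos hpe, if_neg (by omega)] at c₂
    omega
  subst hie
  have hleft : rowCount c T e (r * c) = (k + 1 : ℕ) := by
    refine rowCount_eq hk fun j' hj' => ⟨fun h' => ?_, fun h' => ?_⟩
    · by_contra hlt
      have h₁ := hT.row_le (i := e) (j := k + 1) (j' := j') (by omega) (by omega) hj'
      have h₂ := H.lt_of_le hQ (i := e) (by omega) (by omega) (hk1 (by omega))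
      omega
    · have := hT.row_le (i := e) (j := j') (j' := k) (by omega) (by omega) hk
      omega
  have hright : rowCount c P (r - 1 - e) m = (j : ℕ) := by
    refine rowCount_eq hj.le fun j' hj' => ⟨fun h' => ?_, fun h' => ?_⟩
    · by_contra hlt
      have := hP'.row_le hi (not_lt.1 hlt) hj'
      omega
    · have := hP'.row_lt hi h' hj
      omega
  have hmid := H.mid k hk (r - 1 - e) (by omega)
  rw [hhk, show e + 1 + (r - 1 - e) = r by omega] at hmid
  rw [hmid, show c - 1 - j = k by omega]

theorem promPerm_stack (hP : IsSYT r c P) (hQ : IsSYT r c Q) {i j : ℕ} (hi : i < r)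
    (hj : j < c) :
    promPerm (2 * r) c (stack r c P Q) r (P i j) - r * c = Q i (c - 1 - j) := by
  have h₁ := (hP.isShiftedSYT.mem_Icc hi hj).1
  have h₂ := hQ.isShiftedSYT.mem_Icc (i := i) (j := c - 1 - j) hi (by omega)
  rw [promPerm, slideInto_iterate_stack hP hQ hi hj (show P i j = P i j - 1 + 1 by omega),
    mul_assoc, Nat.mod_eq_of_lt (by omega)]
  omega

theorem bijOn_promPerm_stack (hP : IsSYT r c P) (hQ : IsSYT r c Q) :
    Set.BijOn (fun j => promPerm (2 * r) c (stack r c P Q) r j - r * c)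
      (Set.Icc 1 (r * c)) (Set.Icc 1 (r * c)) := by
  have hP' := hP.isShiftedSYT
  have hQ' := hQ.isShiftedSYT
  have hex : ∀ x ∈ Set.Icc 1 (r * c), ∃ i j, i < r ∧ j < c ∧ P i j = x := fun x hx =>
    hP'.exists_eq (by simpa using hx.1) (by simpa using hx.2)
  refine ⟨fun x hx => ?_, fun x hx y hy hxy => ?_, fun x hx => ?_⟩
  · obtain ⟨i, j, hi, hj, rfl⟩ := hex x hx
    have := hQ'.mem_Icc (i := i) (j := c - 1 - j) hi (by omega)
    simp only [promPerm_stack hP hQ hi hj, Set.mem_Icc]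
    omega
  · obtain ⟨i, j, hi, hj, rfl⟩ := hex x hx
    obtain ⟨i', j', hi', hj', rfl⟩ := hex y hy
    simp only [promPerm_stack hP hQ hi hj, promPerm_stack hP hQ hi' hj'] at hxy
    obtain ⟨rfl, h⟩ := hQ'.inj hi (by omega) hi' (by omega) hxy
    obtain rfl : j = j' := by omega
    rfl
  · obtain ⟨i, j, hi, hj, rfl⟩ := hQ'.exists_eq (x := x) (by simpa using hx.1)
      (by simpa using hx.2)
    refine ⟨P i (c - 1 - j), ?_, ?_⟩
    · simpa using hP'.mem_Icc (i := i) (j := c - 1 - j) hi (by omega)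
    · simp only [promPerm_stack hP hQ hi (show c - 1 - j < c by omega)]
      rw [show c - 1 - (c - 1 - j) = j by omega]

end Stack

/-! ## Row insertion into a tableau given by its rows -/

theorem rowInsert_map_range' {M j₀ : ℕ} {ρ ρ' : ℕ → List ℕ} {x : ℕ → ℕ} (hM : j₀ ≤ M)
    (hbump : ∀ j < j₀, ∃ A B, (∀ y ∈ A, y < x j) ∧ x j ≤ x (j + 1) ∧ ρ j = A ++ x (j + 1) :: B ∧
      ρ' j = A ++ x j :: B)
    (hlt : ∀ y ∈ ρ j₀, y < x j₀) (happ : ρ' j₀ = ρ j₀ ++ [x j₀]) (hnil : j₀ = M → ρ j₀ = [])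
    (htail : ∀ j, j₀ < j → ρ' j = ρ j) {j : ℕ} (hj : j ≤ j₀) :
    rowInsert ((List.range' j (M - j)).map ρ) (x j) =
      (List.range' j (max M (j₀ + 1) - j)).map ρ' := by
  induction hj using Nat.decreasingInduction with
  | self =>
    rcases hM.eq_or_lt with h | h
    · subst h
      simp [rowInsert, happ, hnil rfl]
    · obtain ⟨d, hd⟩ := Nat.exists_eq_add_of_lt h
      rw [max_eq_left h, show M - j₀ = d + 1 by omega, List.range'_succ, List.map_cons,
        List.map_cons, rowInsert]
      rw [List.dropWhile_eq_nil_iff.2 (by simpa using hlt), happ]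
      simp only [List.cons.injEq, true_and]
      exact List.map_congr_left fun j hj => (htail j (by rw [List.mem_range'_1] at hj; omega)).symm
  | of_succ j hj ih =>
    obtain ⟨A, B, hA, hx, h₁, h₂⟩ := hbump j hj
    obtain ⟨d, hd⟩ := Nat.exists_eq_add_of_lt (show j < M by omega)
    rw [show M - j = (M - (j + 1)) + 1 by omega,
      show max M (j₀ + 1) - j = (max M (j₀ + 1) - (j + 1)) + 1 by omega,
      List.range'_succ, List.range'_succ, List.map_cons, List.map_cons, rowInsert, h₁,
      List.dropWhile_append_of_pos (by simpa using hA),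
      List.takeWhile_append_of_pos (by simpa using hA),
      List.dropWhile_cons_of_neg (by simpa using hx),
      List.takeWhile_cons_of_neg (by simpa using hx), h₂]
    simp [ih]

theorem getD_map_range {M : ℕ} {ρ : ℕ → List ℕ} (hρ : ∀ j, M ≤ j → ρ j = []) (j : ℕ) :
    ((List.range M).map ρ).getD j [] = ρ j := by
  by_cases h : j < M
  · simp [h]
  · simp [h, hρ j (not_lt.1 h)]

theorem rowOfNewCell_map_range {M j₀ : ℕ} {ρ ρ' : ℕ → List ℕ}
    (hρ : ∀ j, M ≤ j → ρ j = []) (hne : (ρ' j₀).length ≠ (ρ j₀).length)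
    (heq : ∀ j, j ≠ j₀ → (ρ' j).length = (ρ j).length) :
    rowOfNewCell ((List.range M).map ρ) ((List.range (max M (j₀ + 1))).map ρ') = j₀ := by
  have hρ' : ∀ j, max M (j₀ + 1) ≤ j → ρ' j = [] := fun j hj =>
    List.length_eq_zero_iff.1 (by rw [heq j (by omega), hρ j (by omega), List.length_nil])
  have : (List.range (max M (j₀ + 1))).find? (fun j => decide
      ((((List.range (max M (j₀ + 1))).map ρ').getD j []).length ≠
        (((List.range M).map ρ).getD j []).length)) = some j₀ := by
    rw [List.find?_range_eq_some]
    simp only [getD_map_range hρ, getD_map_range hρ', List.mem_range]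
    refine ⟨by simpa using hne, by omega, fun j hj => ?_⟩
    simp [heq j (by omega)]
  rw [rowOfNewCell, List.length_map, List.length_range, this, Option.getD_some]

theorem placeInRow_map_range {M j₀ k : ℕ} {ρ ρ' : ℕ → List ℕ} (hM : j₀ ≤ M)
    (hnil : j₀ = M → ρ j₀ = []) (happ : ρ' j₀ = ρ j₀ ++ [k]) (heq : ∀ j, j ≠ j₀ → ρ' j = ρ j) :
    placeInRow ((List.range M).map ρ) j₀ k = (List.range (max M (j₀ + 1))).map ρ' := by
  rw [placeInRow, List.length_map, List.length_range]
  split_ifs with h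
  · rw [max_eq_left h]
    refine List.ext_getElem (by simp) fun j h₁ h₂ => ?_
    rw [List.getElem_set]
    split_ifs with hj
    · subst hj
      simp [happ, h]
    · simp [heq j (Ne.symm hj)]
  · obtain rfl : j₀ = M := by omega
    rw [max_eq_right (Nat.le_succ _), List.range_succ, List.map_append]
    simp only [List.map_cons, List.map_nil, happ, hnil rfl, List.nil_append]
    congr 1
    exact List.map_congr_left fun j hj => (heq j (List.mem_range.1 hj).ne).symm

/-! ## Robinson–Schensted for a word built from two rectangular tableaux -/

/-- The insertion tableau with column heights `μ` and row lengths `ν` whose `i`-th column consists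
of the last `μ i` entries of the `i`-th row of `Q`. -/
def insertionTab (c : ℕ) (Q : ℕ → ℕ → ℕ) (μ ν : ℕ → ℕ) : List (List ℕ) :=
  (List.range (μ 0)).map fun j => (List.range (ν j)).map fun i => Q i (c - μ i + j)

/-- The recording tableau with column heights `μ` and row lengths `ν` whose columns are the initial
parts of the rows of `P`. -/
def recordingTab (P : ℕ → ℕ → ℕ) (μ ν : ℕ → ℕ) : List (List ℕ) :=
  (List.range (μ 0)).map fun j => (List.range (ν j)).map fun i => P i j

/-- The pairs `(μ, ν)` and `(μ', ν')` of conjugate partitions are related by adding a cell in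
column `j₀` of `μ`, row `i₀`. -/
structure IsAddCell (c i₀ j₀ : ℕ) (μ ν μ' ν' : ℕ → ℕ) : Prop where
  conj : ∀ i j, j < μ i ↔ i < ν j
  le : ∀ i, μ i ≤ c
  lt : j₀ < c
  left : μ i₀ = j₀
  right : ν j₀ = i₀
  left' : μ' = Function.update μ i₀ (j₀ + 1)
  right' : ν' = Function.update ν j₀ (i₀ + 1)

namespace IsAddCell

variable {r c i₀ j₀ : ℕ} {μ ν μ' ν' : ℕ → ℕ} {P Q : ℕ → ℕ → ℕ}

theorem le_left_zero (h : IsAddCell c i₀ j₀ μ ν μ' ν') : j₀ ≤ μ 0 := by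
  by_contra hlt
  have h₁ := (h.conj 0 (μ 0)).not.1 (lt_irrefl _)
  have h₂ := (h.conj i₀ (μ 0)).1 (by rw [h.left]; omega)
  omega

theorem left_zero' (h : IsAddCell c i₀ j₀ μ ν μ' ν') : μ' 0 = max (μ 0) (j₀ + 1) := by
  rw [h.left']
  rcases Nat.eq_zero_or_pos i₀ with hi | hi
  · have := h.left
    subst hi
    rw [Function.update_self]
    omega
  · rw [Function.update_of_ne hi.ne]
    have := (h.conj 0 j₀).2 (by rw [h.right]; exact hi)
    omega

theorem right_le (h : IsAddCell c i₀ j₀ μ ν μ' ν') {j : ℕ} (hj : j₀ ≤ j) : ν j ≤ i₀ := by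
  by_contra hlt
  have := (h.conj i₀ j).2 (by omega)
  rw [h.left] at this
  omega

theorem right_nil (h : IsAddCell c i₀ j₀ μ ν μ' ν') {j : ℕ} (hj : μ 0 ≤ j) : ν j = 0 := by
  have := (h.conj 0 j).not.1 (by omega)
  omega

theorem rowInsert_insertionTab (h : IsAddCell c i₀ j₀ μ ν μ' ν') (hi : i₀ < r)
    (hQ : IsSYT r c Q) :
    rowInsert (insertionTab c Q μ ν) (Q i₀ (c - 1 - j₀)) = insertionTab c Q μ' ν' := by
  have hQ' := hQ.isShiftedSYT
  have hlt := h.lt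
  have hval : ∀ i < i₀, ∀ j ≤ j₀, Q i (c - μ i + j) < Q i₀ (c - 1 - j₀ + j) := by
    intro i hii j hj
    have h₁ := (h.conj i j₀).2 (by rw [h.right]; exact hii)
    have h₂ := h.le i
    exact (hQ'.row_le (by omega) (show c - μ i + j ≤ c - 1 - j₀ + j by omega)
      (by omega)).trans_lt (hQ'.col_lt hii hi (by omega))
  have hold : ∀ i ≠ i₀, μ' i = μ i := fun i hne => by rw [h.left', Function.update_of_ne hne]
  have hnew : μ' i₀ = j₀ + 1 := by rw [h.left', Function.update_self]
  have key := rowInsert_map_range' (M := μ 0) (j₀ := j₀) (j := 0)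
    (ρ := fun j => (List.range (ν j)).map fun i => Q i (c - μ i + j))
    (ρ' := fun j => (List.range (ν' j)).map fun i => Q i (c - μ' i + j))
    (x := fun j => Q i₀ (c - 1 - j₀ + j)) h.le_left_zero ?_ ?_ ?_ ?_ ?_ (Nat.zero_le _)
  · simpa [← List.range_eq_range', insertionTab, h.left_zero'] using key
  · intro j hj
    have h₁ := (h.conj i₀ j).1 (by rw [h.left]; exact hj)
    obtain ⟨d, hd⟩ := Nat.exists_eq_add_of_lt h₁
    refine ⟨(List.range i₀).map fun i => Q i (c - μ i + j),
      (List.range' (i₀ + 1) d).map fun i => Q i (c - μ i + j), ?_, ?_, ?_, ?_⟩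
    · intro y hy
      obtain ⟨i, hii, rfl⟩ := List.mem_map.1 hy
      exact hval i (List.mem_range.1 hii) j hj.le
    · exact hQ'.row_le hi (by omega) (by omega)
    · rw [hd, add_assoc, List.range_eq_range', ← List.range'_append_1, zero_add,
        List.range'_succ, List.map_append, List.map_cons, List.range_eq_range', h.left,
        show c - j₀ + j = c - 1 - j₀ + (j + 1) by omega]
    · rw [h.right', Function.update_of_ne hj.ne, hd, add_assoc, List.range_eq_range',
        ← List.range'_append_1, zero_add, List.range'_succ, List.map_append, List.map_cons,
        List.range_eq_range', hnew, show c - (j₀ + 1) + j = c - 1 - j₀ + j by omega]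
      congr 1
      · refine List.map_congr_left fun i hii => ?_
        rw [List.mem_range'_1] at hii
        rw [hold i (by omega)]
      · congr 1
        refine List.map_congr_left fun i hii => ?_
        rw [List.mem_range'_1] at hii
        rw [hold i (by omega)]
  · intro y hy
    obtain ⟨i, hii, rfl⟩ := List.mem_map.1 hy
    rw [List.mem_range, h.right] at hii
    exact hval i hii j₀ le_rfl
  · rw [h.right', Function.update_self, h.right, List.range_succ, List.map_append, List.map_cons,
      List.map_nil, hnew, show c - (j₀ + 1) + j₀ = c - 1 - j₀ + j₀ by omega]
    congr 1
    refine List.map_congr_left fun i hii => ?_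
    rw [hold i (List.mem_range.1 hii).ne]
  · intro he
    simp [h.right_nil he.ge]
  · intro j hj
    rw [h.right', Function.update_of_ne hj.ne']
    refine List.map_congr_left fun i hii => ?_
    have := h.right_le hj.le
    rw [List.mem_range] at hii
    rw [hold i (by omega)]

theorem rowOfNewCell_insertionTab (h : IsAddCell c i₀ j₀ μ ν μ' ν') :
    rowOfNewCell (insertionTab c Q μ ν) (insertionTab c Q μ' ν') = j₀ := by
  rw [insertionTab, insertionTab, h.left_zero']
  refine rowOfNewCell_map_range (fun j hj => by simp [h.right_nil hj]) ?_ fun j hj => ?_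
  · simp [h.right', h.right]
  · simp [h.right', hj]

theorem placeInRow_recordingTab (h : IsAddCell c i₀ j₀ μ ν μ' ν') :
    placeInRow (recordingTab P μ ν) j₀ (P i₀ j₀) = recordingTab P μ' ν' := by
  rw [recordingTab, recordingTab, h.left_zero']
  refine placeInRow_map_range h.le_left_zero (fun he => by simp [h.right_nil he.ge]) ?_
    fun j hj => ?_
  · simp [h.right', h.right, List.range_succ]
  · simp [h.right', hj]

end IsAddCell

theorem exists_lt_iff {p : ℕ → Prop} {c : ℕ} (h : ∀ j j', j ≤ j' → p j' → p j)
    (hc : ∀ j, p j → j < c) : ∃ k ≤ c, ∀ j, p j ↔ j < k := by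
  classical
  have hex : ∃ k, ¬ p k := ⟨c, fun hp => (hc c hp).false⟩
  refine ⟨Nat.find hex, Nat.find_min' hex fun hp => (hc c hp).false, fun j => ⟨fun hp => ?_,
    fun hlt => not_not.1 (Nat.find_min hex hlt)⟩⟩
  by_contra hle
  exact Nat.find_spec hex (h _ _ (not_lt.1 hle) hp)

theorem transposeT_toListT {r c : ℕ} (hr : 0 < r) (T : ℕ → ℕ → ℕ) :
    transposeT (toListT r c T) =
      (List.range c).map fun j => (List.range r).map fun i => T i j := by
  have hlen : ((toListT r c T).getD 0 []).length = c := by simp [toListT, hr]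
  rw [transposeT, hlen]
  refine List.map_congr_left fun j hj => ?_
  rw [toListT, List.filterMap_map, ← List.filterMap_eq_map]
  refine List.filterMap_congr fun i _ => ?_
  simp [List.mem_range.1 hj]

theorem RS_eq_transposeT {r c : ℕ} {P Q : ℕ → ℕ → ℕ} (hr : 0 < r) (hP : IsSYT r c P)
    (hQ : IsSYT r c Q) (w : ℕ → ℕ)
    (hw : ∀ i < r, ∀ j < c, w (P i j) = Q i (c - 1 - j)) :
    RS ((List.range (r * c)).map fun t => w (t + 1)) =
      (transposeT (toListT r c Q), transposeT (toListT r c P)) := by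
  have hP' := hP.isShiftedSYT
  have hμ : ∀ t i, ∃ k ≤ c, ∀ j, (i < r ∧ j < c ∧ P i j ≤ t) ↔ j < k := fun t i =>
    exists_lt_iff (fun j j' hj ⟨h₁, h₂, h₃⟩ =>
      ⟨h₁, hj.trans_lt h₂, (hP'.row_le h₁ hj h₂).trans h₃⟩) fun j h => h.2.1
  have hν : ∀ t j, ∃ k ≤ r, ∀ i, (i < r ∧ j < c ∧ P i j ≤ t) ↔ i < k := fun t j =>
    exists_lt_iff (fun i i' hi ⟨h₁, h₂, h₃⟩ =>
      ⟨hi.trans_lt h₁, h₂, (hP'.col_le hi h₁ h₂).trans h₃⟩) fun i h => h.1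
  choose μ hμc hμ using hμ
  choose ν hνr hν using hν
  have hadd : ∀ t i₀ j₀, i₀ < r → j₀ < c → P i₀ j₀ = t + 1 →
      IsAddCell c i₀ j₀ (μ t) (ν t) (μ (t + 1)) (ν (t + 1)) := by
    intro t i₀ j₀ hi hj ht
    have hiff : ∀ i j, (i < r ∧ j < c ∧ P i j ≤ t + 1) ↔
        (i < r ∧ j < c ∧ P i j ≤ t) ∨ (i = i₀ ∧ j = j₀) := by
      intro i j
      constructor
      · rintro ⟨h₁, h₂, h₃⟩
        by_cases h : P i j ≤ t
        · exact Or.inl ⟨h₁, h₂, h⟩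
        · exact Or.inr (hP'.inj h₁ h₂ hi hj (by omega))
      · rintro (⟨h₁, h₂, h₃⟩ | ⟨rfl, rfl⟩)
        · exact ⟨h₁, h₂, by omega⟩
        · exact ⟨hi, hj, ht.le⟩
    have hl : μ t i₀ = j₀ := eq_of_forall_lt_iff fun j => by
      rw [← hμ]
      refine ⟨fun ⟨_, h₂, h₃⟩ => ?_, fun h => ⟨hi, by omega, ?_⟩⟩
      · by_contra hle
        have := hP'.row_le hi (not_lt.1 hle) h₂
        omega
      · have := hP'.row_lt hi h hj
        omega
    have hrr : ν t j₀ = i₀ := eq_of_forall_lt_iff fun i => by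
      rw [← hν]
      refine ⟨fun ⟨h₁, _, h₃⟩ => ?_, fun h => ⟨by omega, hj, ?_⟩⟩
      · by_contra hle
        have := hP'.col_le (not_lt.1 hle) h₁ hj
        omega
      · have := hP'.col_lt h hi hj
        omega
    refine ⟨fun i j => by rw [← hμ, ← hν], hμc t, hj, hl, hrr, ?_, ?_⟩
    · funext i
      refine eq_of_forall_lt_iff fun j => ?_
      rw [← hμ, hiff, hμ]
      by_cases h : i = i₀
      · subst h
        rw [Function.update_self, hl]
        omega
      · rw [Function.update_of_ne h]
        simp [h]
    · funext j
      refine eq_of_forall_lt_iff fun i => ?_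
      rw [← hν, hiff, hν]
      by_cases h : j = j₀
      · subst h
        rw [Function.update_self, hrr]
        omega
      · rw [Function.update_of_ne h]
        simp [h]
  have hfold : ∀ t ≤ r * c, (List.range t).foldl
      (fun PQ i =>
        let P' := rowInsert PQ.1 (((List.range (r * c)).map fun t => w (t + 1)).getD i 0)
        (P', placeInRow PQ.2 (rowOfNewCell PQ.1 P') (i + 1)))
      ([], []) = (insertionTab c Q (μ t) (ν t), recordingTab P (μ t) (ν t)) := by
    intro t ht
    induction t with
    | zero =>
      have : μ 0 0 = 0 := by
        by_contra h
        obtain ⟨h₁, h₂, h₃⟩ := (hμ 0 0 0).2 (by omega)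
        have := (hP'.mem_Icc h₁ h₂).1
        omega
      simp [insertionTab, recordingTab, this]
    | succ t ih =>
      obtain ⟨i, j, hi, hj, hij⟩ := hP'.exists_eq (x := t + 1) (by omega) (by omega)
      have h := hadd t i j hi hj hij
      have hwt : ((List.range (r * c)).map fun t => w (t + 1)).getD t 0 = Q i (c - 1 - j) := by
        rw [← hw i hi j hj, hij]
        simp [show t < r * c by omega]
      rw [List.range_succ, List.foldl_append, ih (by omega)]
      simp only [List.foldl_cons, List.foldl_nil, hwt]
      rw [h.rowInsert_insertionTab hi hQ, h.rowOfNewCell_insertionTab, ← hij,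
        h.placeInRow_recordingTab, hij]
  have hμn : ∀ i < r, μ (r * c) i = c := fun i hi => eq_of_forall_lt_iff fun j => by
    rw [← hμ]
    refine ⟨fun h => h.2.1, fun h => ⟨hi, h, ?_⟩⟩
    simpa using (hP'.mem_Icc hi h).2
  have hνn : ∀ j < c, ν (r * c) j = r := fun j hj => eq_of_forall_lt_iff fun i => by
    rw [← hν]
    refine ⟨fun h => h.1, fun h => ⟨h, hj, ?_⟩⟩
    simpa using (hP'.mem_Icc h hj).2
  rw [RS, List.length_map, List.length_range, hfold _ le_rfl, transposeT_toListT hr,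
    transposeT_toListT hr, insertionTab, recordingTab, hμn 0 hr]
  refine Prod.ext ?_ ?_ <;> refine List.map_congr_left fun j hj => ?_ <;>
    rw [hνn j (List.mem_range.1 hj)]
  refine List.map_congr_left fun i hi => ?_
  rw [hμn i (List.mem_range.1 hi), Nat.sub_self, zero_add]

/-- For `P, Q ∈ SYT(r × c)` with `n = rc`, the sequence
`prom_r^NE(stack(P, Q))` is a permutation of `{1, …, n}`, and applying Robinson–Schensted
to it yields the pair `(Q^⊤, P^⊤)`; that is, it equals `RS⁻¹(Q^⊤, P^⊤)`. -/
theorem promNE_stack_eq_RS_inv (r c : ℕ) (hr : 1 ≤ r) (hc : 1 ≤ c)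
    (P Q : ℕ → ℕ → ℕ) (hP : IsSYT r c P) (hQ : IsSYT r c Q) :
    Set.BijOn (fun j => promPerm (2 * r) c (stack r c P Q) r j - r * c)
      (Set.Icc 1 (r * c)) (Set.Icc 1 (r * c)) ∧
    RS ((List.range (r * c)).map fun j =>
        promPerm (2 * r) c (stack r c P Q) r (j + 1) - r * c) =
      (transposeT (toListT r c Q), transposeT (toListT r c P)) :=
  ⟨bijOn_promPerm_stack hP hQ, RS_eq_transposeT hr hP hQ
    (fun j => promPerm (2 * r) c (stack r c P Q) r j - r * c)
    fun _ hi _ hj => promPerm_stack hP hQ hi hj⟩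

end PromRS
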